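/- arXiv:2102.04900 — 2 statements merged into one kernel-verified Lean document; each statement's English description precedes it below -/
import Mathlib

section
/- For every C₀ > 1 and every δ > 0 there exist ρ > 0 and ε₀ > 0 such that for all ε ∈ (0, ε₀) and all x ∈ Ω_ε with C₀·ε ≤ |x − x₀| ≤ ρ, the Hessian satisfies, for all i, j ∈ {1,2}: |∂²u_ε(x)/∂x_i∂x_j − ∂²u₀(x)/∂x_i∂x_j − (u₀(x₀)/(|log ε|·|x − x₀|²))·(δ_{ij} − 2(x_i − x₀,ᵢ)(x_j − x₀,ⱼ)/|x − x₀|²)| ≤ δ/(|log ε|·|x − x₀|²), where δ_{ij} is the Kronecker delta and x₀,ᵢ denotes the i-th coordinate of x₀. -/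
open Real Set Metric Filter Topology

noncomputable section

abbrev E2 := EuclideanSpace ℝ (Fin 2)

/-- Second partial derivative `∂²u/∂xᵢ∂xⱼ` at `x`. -/
noncomputable def pd2 (u : E2 → ℝ) (x : E2) (i j : Fin 2) : ℝ :=
  fderiv ℝ (fun y => fderiv ℝ u y (EuclideanSpace.single j 1)) x (EuclideanSpace.single i 1)

/-- The Hessian matrix `D²u(x)`. -/
noncomputable def Hess (u : E2 → ℝ) (x : E2) : Matrix (Fin 2) (Fin 2) ℝ :=
  Matrix.of fun i j => pd2 u x i j

/-- The Laplacian `Δu(x)`. -/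
noncomputable def lap (u : E2 → ℝ) (x : E2) : ℝ := pd2 u x 0 0 + pd2 u x 1 1

/-- The largest eigenvalue of a symmetric 2×2 real matrix. -/
noncomputable def lambdaMax (M : Matrix (Fin 2) (Fin 2) ℝ) : ℝ :=
  ((M 0 0 + M 1 1) + Real.sqrt ((M 0 0 - M 1 1) ^ 2 + (M 0 1 + M 1 0) ^ 2)) / 2

/-- `u` is the torsion function of `U`: continuous up to the boundary, `C²` inside,
`Δu = -1` in `U` and `u = 0` on `∂U`. -/
def IsTorsion (U : Set E2) (u : E2 → ℝ) : Prop :=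
  ContinuousOn u (closure U) ∧ (∀ x ∈ U, ContDiffAt ℝ 2 u x) ∧
    (∀ x ∈ U, lap u x = -1) ∧ (∀ x ∈ frontier U, u x = 0)


open InnerProductSpace in
/-- Weak maximum principle for harmonic functions on a bounded open subset of the plane. -/
theorem InnerProductSpace.HarmonicOnNhd.le_of_frontier_le {U : Set ℂ} (hUo : IsOpen U)
    (hUb : Bornology.IsBounded U) {f : ℂ → ℝ} (hf : HarmonicOnNhd f U)
    (hc : ContinuousOn f (closure U)) {M : ℝ} (hM : ∀ z ∈ frontier U, f z ≤ M) :
    ∀ z ∈ U, f z ≤ M := by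
  intro z hz
  have hK : IsCompact (closure U) := hUb.isCompact_closure
  obtain ⟨p, hpU, hp⟩ := hK.exists_isMaxOn ⟨z, subset_closure hz⟩ hc
  rw [isMaxOn_iff] at hp
  by_contra! hlt
  have hpM : M < f p := hlt.trans_le (hp z (subset_closure hz))
  set S : Set ℂ := {x | x ∈ closure U ∧ f x = f p} with hS
  have hSU : S ⊆ U := by
    rintro x ⟨hx, hxp⟩
    by_contra hxU
    have := hM x (by rw [hUo.frontier_eq]; exact ⟨hx, hxU⟩)
    linarith
  have hSclosed : IsClosed S := hc.preimage_isClosed_of_isClosed isClosed_closure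
    (isClosed_singleton (x := f p))
  have hSopen : IsOpen S := by
    rw [isOpen_iff_mem_nhds]
    intro x hx
    obtain ⟨r, hr, hrU⟩ := Metric.isOpen_iff.1 hUo x (hSU hx)
    obtain ⟨F, hFa, hFre⟩ := HarmonicOnNhd.exists_analyticOnNhd_ball_re_eq
      (fun y hy => hf y (hrU hy) : HarmonicOnNhd f (ball x r))
    have hnorm : ∀ y ∈ ball x r, ‖Complex.exp (F y)‖ = Real.exp (f y) := fun y hy => by
      rw [Complex.norm_exp]
      exact congrArg _ (hFre hy)
    have hball : ball x r ∈ 𝓝 x := ball_mem_nhds x hr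
    have hd : ∀ᶠ y in 𝓝 x, DifferentiableAt ℂ (fun y => Complex.exp (F y)) y := by
      filter_upwards [hball] with y hy using (hFa y hy).differentiableAt.cexp
    have hmax : IsLocalMax (norm ∘ fun y => Complex.exp (F y)) x := by
      filter_upwards [hball] with y hy
      simp only [Function.comp]
      rw [hnorm y hy, hnorm x (mem_ball_self hr), hx.2]
      exact Real.exp_le_exp.2 (hp y (subset_closure (hrU hy)))
    filter_upwards [Complex.eventually_eq_of_isLocalMax_norm hd hmax, hball] with y hy hyb
    refine ⟨subset_closure (hrU hyb), ?_⟩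
    have := congrArg norm hy
    rw [hnorm y hyb, hnorm x (mem_ball_self hr), Real.exp_eq_exp] at this
    rw [this, hx.2]
  rcases isClopen_iff.1 ⟨hSclosed, hSopen⟩ with h | h
  · exact (h ▸ (⟨hpU, rfl⟩ : p ∈ S) : p ∈ (∅ : Set ℂ))
  · exact NormedSpace.unbounded_univ ℝ ℂ (hUb.subset (h ▸ hSU))

open InnerProductSpace in
/-- Interior gradient estimate for a bounded harmonic function on a disc. -/
theorem InnerProductSpace.HarmonicOnNhd.norm_complex_partial_le {f : ℂ → ℝ} {c : ℂ} {r M : ℝ}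
    (hr : 0 < r) (hM : 0 < M) (hf : HarmonicOnNhd f (ball c r)) (hb : ∀ z ∈ ball c r, |f z| ≤ M) :
    ‖(fderiv ℝ f c 1 : ℂ) - Complex.I * fderiv ℝ f c Complex.I‖ ≤ 10 * M / r := by
  obtain ⟨F, hFa, hFre⟩ := HarmonicOnNhd.exists_analyticOnNhd_ball_re_eq hf
  have hc : c ∈ ball c r := mem_ball_self hr
  have hFd := (hFa c hc).differentiableAt.hasDerivAt
  have hfF : f =ᶠ[𝓝 c] fun z => (F z).re := by
    filter_upwards [ball_mem_nhds c hr] with z hz using (hFre hz).symm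
  have hre : HasFDerivAt (fun z => (F z).re)
      (Complex.reCLM.comp ((ContinuousLinearMap.toSpanSingleton ℂ (deriv F c)).restrictScalars ℝ)) c :=
    Complex.reCLM.hasFDerivAt.comp c (hFd.hasFDerivAt.restrictScalars ℝ)
  have hval : (fderiv ℝ f c 1 : ℂ) - Complex.I * fderiv ℝ f c Complex.I = deriv F c := by
    rw [hfF.fderiv_eq, hre.fderiv]
    apply Complex.ext <;> simp
  rw [hval]
  set G : ℂ → ℂ := fun z => F (c + z) - (F c).im * Complex.I with hG
  have hmem : ∀ z ∈ ball (0 : ℂ) r, c + z ∈ ball c r := fun z hz => by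
    simpa [mem_ball, dist_eq_norm] using hz
  have hGd : DifferentiableOn ℂ G (ball 0 r) := fun z hz => by
    have h1 : DifferentiableAt ℂ F (c + z) := (hFa _ (hmem z hz)).differentiableAt
    exact ((h1.comp z (by fun_prop)).sub_const _).differentiableWithinAt
  have hGre : ∀ z ∈ ball (0 : ℂ) r, (G z).re = f (c + z) := fun z hz => by
    simp [hG, ← hFre (hmem z hz)]
  have hG0 : ‖G 0‖ ≤ M := by
    have h1 : G 0 = ((f c : ℝ) : ℂ) := by
      apply Complex.ext <;> simp [hG, ← hFre hc]
    rw [h1, Complex.norm_real]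
    exact hb c hc
  have hGb : ∀ z ∈ sphere (0 : ℂ) (r / 2), ‖G z‖ ≤ 5 * M := fun z hz => by
    have hz' : ‖z‖ = r / 2 := by simpa using hz
    have hzb : z ∈ ball (0 : ℂ) r := by simp [hz']; linarith
    have h1 := Complex.borelCaratheodory hM hGd (fun w hw => by
      simp only [Set.mem_ofPred_eq]
      rw [hGre w hw]
      exact (le_abs_self _).trans (hb _ (hmem w hw))) hr hzb
    rw [hz'] at h1
    have h2 : 2 * M * (r / 2) / (r - r / 2) + ‖G 0‖ * (r + r / 2) / (r - r / 2)
        = 2 * M + 3 * ‖G 0‖ := by field_simp; ring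
    linarith
  have hGcl : DiffContOnCl ℂ G (ball 0 (r / 2)) := by
    apply DifferentiableOn.diffContOnCl
    apply hGd.mono
    rw [closure_ball _ (by positivity)]
    exact closedBall_subset_ball (by linarith)
  have h3 := Complex.norm_deriv_le_of_forall_mem_sphere_norm_le (by positivity) hGcl hGb
  have h4 : deriv G 0 = deriv F c := by
    simp only [hG, deriv_sub_const_fun]
    rw [deriv_comp_const_add]
    simp
  rw [h4] at h3
  calc _ ≤ _ := h3
    _ = 10 * M / r := by field_simp; norm_num

/-- Cauchy estimate on an annulus: a holomorphic function is controlled by its values on the two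
boundary circles. -/
theorem norm_le_of_differentiableOn_annulus {g : ℂ → ℂ} {r R a b : ℝ} (hr : 0 < r)
    {s : Set ℂ} (hs : IsOpen s) (hsub : ∀ w : ℂ, r ≤ ‖w‖ → ‖w‖ ≤ R → w ∈ s)
    (hg : DifferentiableOn ℂ g s)
    (ha : ∀ w : ℂ, ‖w‖ = r → ‖g w‖ ≤ a) (hb : ∀ w : ℂ, ‖w‖ = R → ‖g w‖ ≤ b)
    {z : ℂ} (hz : r < ‖z‖) (hzR : ‖z‖ < R) :
    ‖g z‖ ≤ a * (r / (‖z‖ - r)) + b * (R / (R - ‖z‖)) := by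
  have hzs : z ∈ s := hsub z hz.le hzR.le
  have hzn : s ∈ 𝓝 z := hs.mem_nhds hzs
  have hslope : DifferentiableOn ℂ (dslope g z) s :=
    (Complex.differentiableOn_dslope hzn).2 hg
  have hgoursat : (∮ w in C(0, R), dslope g z w) = ∮ w in C(0, r), dslope g z w := by
    apply Complex.circleIntegral_eq_of_differentiable_on_annulus_off_countable hr
      (hz.le.trans hzR.le) countable_empty
    · apply hslope.continuousOn.mono
      rintro w ⟨h1, h2⟩
      exact hsub w (by simpa using h2) (by simpa using h1)
    · rintro w ⟨⟨h1, h2⟩, -⟩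
      have : w ∈ s := hsub w (by simp at h2; exact h2.le) (by simp at h1; exact h1.le)
      exact (hslope w this).differentiableAt (hs.mem_nhds this)
  have hsplit : ∀ t : ℝ, 0 < t → r ≤ t → t ≤ R → t ≠ ‖z‖ →
      (∮ w in C(0, t), dslope g z w)
        = (∮ w in C(0, t), (w - z)⁻¹ • g w) - (∮ w in C(0, t), (w - z)⁻¹) * g z := by
    intro t ht hrt htR htz
    have hne : ∀ w ∈ sphere (0 : ℂ) t, w - z ≠ 0 := by
      intro w hw h0
      rw [sub_eq_zero] at h0
      subst h0
      exact htz (by simpa using hw.symm)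
    have hci : ContinuousOn (fun w : ℂ => (w - z)⁻¹) (sphere 0 t) :=
      (continuousOn_id.sub continuousOn_const).inv₀ hne
    have hcg : ContinuousOn g (sphere 0 t) := hg.continuousOn.mono fun w hw =>
      hsub w (by simp at hw; linarith) (by simp at hw; linarith)
    rw [← smul_eq_mul, ← circleIntegral.integral_smul_const, ← circleIntegral.integral_sub]
    · apply circleIntegral.integral_congr ht.le
      intro w hw
      have : w ≠ z := fun h => hne w hw (by simp [h])
      simp only [dslope_of_ne _ this, slope, vsub_eq_sub, smul_eq_mul]
      ring
    · exact (hci.smul hcg).circleIntegrable ht.le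
    · exact (hci.smul continuousOn_const).circleIntegrable ht.le
  have hR : 0 < R := hr.trans (hz.trans hzR)
  rw [hsplit R hR (hz.trans hzR).le le_rfl hzR.ne', hsplit r hr le_rfl (hz.trans hzR).le hz.ne,
    circleIntegral.integral_sub_inv_of_mem_ball (by simpa using hzR)] at hgoursat
  have hzero : (∮ w in C(0, r), (w - z)⁻¹) = 0 := by
    apply DiffContOnCl.circleIntegral_eq_zero hr.le
    apply DifferentiableOn.diffContOnCl
    intro w hw
    rw [closure_ball _ hr.ne'] at hw
    have : w - z ≠ 0 := by
      intro h
      rw [sub_eq_zero] at h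
      subst h
      simp at hw
      linarith
    exact ((differentiableAt_id.sub_const z).inv this).differentiableWithinAt
  rw [hzero, zero_mul, sub_zero] at hgoursat
  have hest : ∀ t d e : ℝ, 0 < t → 0 < d → (∀ w : ℂ, ‖w‖ = t → d ≤ ‖w - z‖) →
      (∀ w : ℂ, ‖w‖ = t → ‖g w‖ ≤ e) →
      ‖∮ w in C(0, t), (w - z)⁻¹ • g w‖ ≤ 2 * π * (e * (t / d)) := by
    intro t d e ht hd hdist he
    have := circleIntegral.norm_integral_le_of_norm_le_const (f := fun w => (w - z)⁻¹ • g w)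
      (c := 0) (C := d⁻¹ * e) ht.le (fun w hw => by
        have hw' : ‖w‖ = t := by simpa using hw
        rw [norm_smul, norm_inv]
        gcongr
        · exact hdist w hw'
        · exact he w hw')
    calc _ ≤ _ := this
      _ = _ := by ring
  have h1 := hest r (‖z‖ - r) a hr (by linarith)
    (fun w hw => by have := norm_sub_norm_le z w; rw [norm_sub_rev] at this; linarith) ha
  have h2 := hest R (R - ‖z‖) b hR (by linarith)
    (fun w hw => by have := norm_sub_norm_le w z; linarith) hb
  have hkey : (2 * π * Complex.I) * g z
      = (∮ w in C(0, R), (w - z)⁻¹ • g w) - ∮ w in C(0, r), (w - z)⁻¹ • g w := by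
    rw [← hgoursat]; ring
  have h3 : ‖(2 * π * Complex.I) * g z‖ = 2 * π * ‖g z‖ := by
    simp [abs_of_pos Real.pi_pos]
  have h4 := norm_sub_le (∮ w in C(0, R), (w - z)⁻¹ • g w) (∮ w in C(0, r), (w - z)⁻¹ • g w)
  rw [← hkey, h3] at h4
  have h5 : 2 * π * ‖g z‖ ≤ 2 * π * (a * (r / (‖z‖ - r)) + b * (R / (R - ‖z‖))) := by
    linarith
  exact le_of_mul_le_mul_left h5 (by positivity)

/-- The holomorphic function `∂f/∂x - i ∂f/∂y` attached to a harmonic function `f`. -/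
def complexPartial (f : ℂ → ℝ) (z : ℂ) : ℂ :=
  (fderiv ℝ f z 1 : ℂ) - Complex.I * fderiv ℝ f z Complex.I

open InnerProductSpace in
/-- Estimate of the second derivatives of a harmonic function on an annulus, in terms of its size
`S` near the inner circle and its size `T` in the whole annulus. -/
theorem norm_deriv_complexPartial_le {V : ℂ → ℝ} {c ε R S T : ℝ} (hc : 0 < c) (hc4 : c ≤ 1 / 4)
    (hε : 0 < ε) (hS : 0 < S) (hT : 0 < T)
    (hV : HarmonicOnNhd V {z | ε < ‖z‖ ∧ ‖z‖ < R})
    (hVS : ∀ z : ℂ, ε < ‖z‖ → ‖z‖ ≤ 2 * ε → |V z| ≤ S)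
    (hVT : ∀ z : ℂ, ε < ‖z‖ → ‖z‖ < R → |V z| ≤ T)
    {z : ℂ} (hz : (1 + 4 * c) * ε ≤ ‖z‖) (hzR : ‖z‖ ≤ R / 8) :
    ‖deriv (complexPartial V) z‖ ≤
      (80 * T / R + 20 * S / (c ^ 2 * ‖z‖)) / (c * ‖z‖ / 4) := by
  set s : Set ℂ := {z | ε < ‖z‖ ∧ ‖z‖ < R} with hs
  have hso : IsOpen s := (isOpen_lt continuous_const continuous_norm).inter
    (isOpen_lt continuous_norm continuous_const)
  have hg : DifferentiableOn ℂ (complexPartial V) s := fun w hw =>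
    (HarmonicAt.differentiableAt_complex_partial (hV w hw)).differentiableWithinAt
  have hcε : 0 < c * ε := by positivity
  have hz0 : 0 < ‖z‖ := by nlinarith
  have hR : 0 < R := by linarith
  have hnorm : ∀ {w y : ℂ} {t : ℝ}, dist y w ≤ t → ‖w‖ - t ≤ ‖y‖ ∧ ‖y‖ ≤ ‖w‖ + t := by
    intro w y t h
    rw [dist_eq_norm] at h
    have h1 := norm_sub_norm_le w y
    have h2 := norm_sub_norm_le y w
    rw [norm_sub_rev] at h1
    exact ⟨by linarith, by linarith⟩
  have hinner : ∀ w : ℂ, ‖w‖ = (1 + 2 * c) * ε → ‖complexPartial V w‖ ≤ 10 * S / (c * ε) := by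
    intro w hw
    have key : ∀ y ∈ ball w (c * ε), ε < ‖y‖ ∧ ‖y‖ ≤ 2 * ε := fun y hy => by
      have := hnorm (mem_ball.1 hy).le
      constructor <;> nlinarith
    exact HarmonicOnNhd.norm_complex_partial_le hcε hS
      (fun y hy => hV y ⟨(key y hy).1, by linarith [(key y hy).2]⟩)
      (fun y hy => hVS y (key y hy).1 (key y hy).2)
  have houter : ∀ w : ℂ, ‖w‖ = R / 2 → ‖complexPartial V w‖ ≤ 10 * T / (R / 4) := by
    intro w hw
    have key : ∀ y ∈ ball w (R / 4), ε < ‖y‖ ∧ ‖y‖ < R := fun y hy => by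
      have := hnorm (mem_ball.1 hy).le
      constructor <;> linarith
    exact HarmonicOnNhd.norm_complex_partial_le (by positivity) hT
      (fun y hy => hV y (key y hy)) (fun y hy => hVT y (key y hy).1 (key y hy).2)
  set q : ℝ := c * ‖z‖ / 4 with hq
  have hq0 : 0 < q := by positivity
  have hnear : ∀ y ∈ closedBall z q, 3 / 4 * c * ‖z‖ ≤ ‖y‖ - (1 + 2 * c) * ε ∧ ‖y‖ ≤ R / 4 := by
    intro y hy
    have h := hnorm (mem_closedBall.1 hy)
    have h1 : (1 + 2 * c) * ε ≤ (1 - c) * ‖z‖ := by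
      have : (1 + 2 * c) * ε ≤ (1 - c) * ((1 + 4 * c) * ε) := by nlinarith
      nlinarith
    constructor
    · linarith
    · nlinarith
  have hbound : ∀ y ∈ closedBall z q,
      ‖complexPartial V y‖ ≤ 80 * T / R + 20 * S / (c ^ 2 * ‖z‖) := by
    intro y hy
    obtain ⟨h1, h2⟩ := hnear y hy
    have h3 : 0 < 3 / 4 * c * ‖z‖ := by positivity
    have h4 := norm_le_of_differentiableOn_annulus (r := (1 + 2 * c) * ε) (R := R / 2)
      (by positivity) hso (fun w h h' => ⟨by nlinarith, by linarith⟩) hg hinner houter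
      (z := y) (by linarith) (by linarith)
    have h5 : 10 * S / (c * ε) * ((1 + 2 * c) * ε / (‖y‖ - (1 + 2 * c) * ε))
        ≤ 20 * S / (c ^ 2 * ‖z‖) := by
      calc _ ≤ 10 * S / (c * ε) * ((3 / 2) * ε / (3 / 4 * c * ‖z‖)) := by
            gcongr
            linarith
        _ = _ := by field_simp; norm_num
    have h6 : 10 * T / (R / 4) * (R / 2 / (R / 2 - ‖y‖)) ≤ 80 * T / R := by
      calc _ ≤ 10 * T / (R / 4) * (R / 2 / (R / 4)) := by
            gcongr
            linarith
        _ = _ := by field_simp; norm_num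
    linarith
  apply Complex.norm_deriv_le_of_forall_mem_sphere_norm_le hq0
  · apply DifferentiableOn.diffContOnCl
    rw [closure_ball _ hq0.ne']
    apply hg.mono
    intro y hy
    obtain ⟨h1, h2⟩ := hnear y hy
    have : 0 < 3 / 4 * c * ‖z‖ := by positivity
    exact ⟨by nlinarith, by linarith⟩
  · exact fun y hy => hbound y (sphere_subset_closedBall hy)

/-- The second partial derivative of a function on the complex plane along two directions. -/
def cpd2 (f : ℂ → ℝ) (z a b : ℂ) : ℝ := fderiv ℝ (fun y => fderiv ℝ f y b) z a

/-- The directions in the complex plane that correspond to the coordinate directions. -/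
def cdir : Fin 2 → ℂ := ![1, Complex.I]

theorem ContDiffAt.cpd2_eq_iteratedFDeriv {f : ℂ → ℝ} {z : ℂ} (hf : ContDiffAt ℝ 2 f z) (a b : ℂ) :
    cpd2 f z a b = iteratedFDeriv ℝ 2 f z ![a, b] := by
  have h1 : DifferentiableAt ℝ (fderiv ℝ f) z :=
    (hf.fderiv_right (m := 1) (by norm_num)).differentiableAt (by norm_num)
  rw [iteratedFDeriv_two_apply, cpd2, fderiv_clm_apply h1 (by fun_prop)]
  simp

open InnerProductSpace in
theorem harmonicOnNhd_of_cpd2 {f : ℂ → ℝ} {U : Set ℂ} (hU : IsOpen U)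
    (hf : ∀ z ∈ U, ContDiffAt ℝ 2 f z)
    (h : ∀ z ∈ U, cpd2 f z 1 1 + cpd2 f z Complex.I Complex.I = 0) : HarmonicOnNhd f U := by
  intro z hz
  refine ⟨hf z hz, ?_⟩
  filter_upwards [hU.mem_nhds hz] with y hy
  rw [laplacian_eq_iteratedFDeriv_complexPlane, Pi.zero_apply, ← h y hy,
    (hf y hy).cpd2_eq_iteratedFDeriv, (hf y hy).cpd2_eq_iteratedFDeriv]

open InnerProductSpace in
theorem abs_cpd2_le {f : ℂ → ℝ} {z : ℂ} (hf : HarmonicAt f z) (i j : Fin 2) :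
    |cpd2 f z (cdir i) (cdir j)| ≤ ‖deriv (complexPartial f) z‖ := by
  have hd : HasDerivAt (complexPartial f) (deriv (complexPartial f) z) z :=
    (HarmonicAt.differentiableAt_complex_partial hf).hasDerivAt
  have hR := hd.hasFDerivAt.restrictScalars ℝ
  have hcoord : (fun y => fderiv ℝ f y 1) = fun y => (complexPartial f y).re := by
    ext y; simp [complexPartial]
  have hcoord' : (fun y => fderiv ℝ f y Complex.I) = fun y => -(complexPartial f y).im := by
    ext y; simp [complexPartial]
  have hre : HasFDerivAt (fun y => (complexPartial f y).re) _ z :=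
    Complex.reCLM.hasFDerivAt.comp z hR
  have him : HasFDerivAt (fun y => (complexPartial f y).im) _ z :=
    Complex.imCLM.hasFDerivAt.comp z hR
  have hre' := Complex.abs_re_le_norm (deriv (complexPartial f) z)
  have him' := Complex.abs_im_le_norm (deriv (complexPartial f) z)
  fin_cases i <;> fin_cases j <;>
    simp only [cpd2, cdir, Fin.zero_eta, Fin.mk_one, Matrix.cons_val_zero, Matrix.cons_val_one,
      hcoord, hcoord', hre.fderiv, fderiv_fun_neg, him.fderiv] <;> simpa

/-- The linear isometry between the complex plane and the Euclidean plane. -/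
def planeIso : ℂ ≃ₗᵢ[ℝ] E2 := Complex.orthonormalBasisOneI.repr

theorem planeIso_cdir (i : Fin 2) : planeIso (cdir i) = EuclideanSpace.single i 1 := by
  rw [planeIso, ← Complex.orthonormalBasisOneI.repr_self i]
  congr 1
  fin_cases i <;> simp [cdir]

theorem planeIso_apply (z : ℂ) (i : Fin 2) : planeIso z i = inner ℝ z (cdir i) := by
  rw [real_inner_comm, ← planeIso.inner_map_map, planeIso_cdir, EuclideanSpace.inner_single_left]
  simp

theorem inner_cdir (i j : Fin 2) : inner ℝ (cdir i) (cdir j) = if i = j then (1 : ℝ) else 0 := by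
  rw [← planeIso_apply, planeIso_cdir]
  simp [eq_comm]

theorem pd2_eq_cpd2 (f : E2 → ℝ) (x₀ : E2) (z : ℂ) (i j : Fin 2) :
    pd2 f (x₀ + planeIso z) i j = cpd2 (fun z => f (x₀ + planeIso z)) z (cdir i) (cdir j) := by
  have h : ∀ (g : E2 → ℝ) (y b : ℂ), fderiv ℝ (fun z => g (x₀ + planeIso z)) y b
      = fderiv ℝ g (x₀ + planeIso y) (planeIso b) := by
    intro g y b
    have := planeIso.toContinuousLinearEquiv.comp_right_fderiv (f := fun w => g (x₀ + w)) (x := y)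
    rw [fderiv_comp_add_left] at this
    exact congrArg (fun L => L b) this
  rw [cpd2, pd2]
  simp only [h, planeIso_cdir]
  rw [← planeIso_cdir i, ← h]

theorem cpd2_sub {f g : ℂ → ℝ} {z : ℂ} (hf : ContDiffAt ℝ 2 f z) (hg : ContDiffAt ℝ 2 g z)
    (a b : ℂ) : cpd2 (fun y => f y - g y) z a b = cpd2 f z a b - cpd2 g z a b := by
  rw [hf.cpd2_eq_iteratedFDeriv, hg.cpd2_eq_iteratedFDeriv, (hf.sub hg).cpd2_eq_iteratedFDeriv]
  have := iteratedFDeriv_sub_apply hf hg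
  rw [Pi.sub_def] at this
  rw [this]
  rfl

theorem cpd2_const_mul (k : ℝ) (f : ℂ → ℝ) (z a b : ℂ) :
    cpd2 (fun y => k * f y) z a b = k * cpd2 f z a b := by
  have h : ∀ (g : ℂ → ℝ) (y b : ℂ), fderiv ℝ (fun z => k * g z) y b = k * fderiv ℝ g y b := by
    intro g y b
    exact congrArg (fun L => L y b) (fderiv_const_smul_field (𝕜 := ℝ) (f := g) k)
  simp only [cpd2, h]

theorem hasFDerivAt_log_norm {z : ℂ} (hz : z ≠ 0) :
    HasFDerivAt (fun y : ℂ => Real.log ‖y‖) ((‖z‖ ^ 2)⁻¹ • innerSL ℝ z) z := by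
  have h1 : (fun y : ℂ => Real.log ‖y‖) = fun y => (1 / 2) * Real.log (‖y‖ ^ 2) := by
    ext y
    rw [Real.log_pow]
    push_cast
    ring
  have hz2 : ‖z‖ ^ 2 ≠ 0 := by simpa using hz
  rw [h1]
  refine (((hasStrictFDerivAt_norm_sq z).hasFDerivAt.log hz2).const_mul (1 / 2)).congr_fderiv ?_
  ext v
  simp
  ring

theorem cpd2_log_norm {z : ℂ} (hz : z ≠ 0) (a b : ℂ) :
    cpd2 (fun y => Real.log ‖y‖) z a b
      = (inner ℝ a b - 2 * inner ℝ z a * inner ℝ z b / ‖z‖ ^ 2) / ‖z‖ ^ 2 := by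
  have hev : (fun y : ℂ => fderiv ℝ (fun y : ℂ => Real.log ‖y‖) y b)
      =ᶠ[𝓝 z] fun y => inner ℝ y b * (‖y‖ ^ 2)⁻¹ := by
    filter_upwards [isOpen_ne.mem_nhds hz] with y hy
    rw [(hasFDerivAt_log_norm hy).fderiv]
    simp [mul_comm]
  have hz2 : ‖z‖ ^ 2 ≠ 0 := by simpa using hz
  have h1 : HasFDerivAt (fun y : ℂ => inner ℝ y b) (innerSL ℝ b) z := by
    have := (innerSL ℝ b).hasFDerivAt (x := z)
    refine this.congr_of_eventuallyEq (Eventually.of_forall fun y => ?_)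
    exact real_inner_comm b y
  have h2 := (hasDerivAt_inv hz2).comp_hasFDerivAt z (hasStrictFDerivAt_norm_sq z).hasFDerivAt
  have h3 : cpd2 (fun y => Real.log ‖y‖) z a b
      = inner ℝ z b * (-((‖z‖ ^ 2) ^ 2)⁻¹ * (2 * inner ℝ z a))
        + (‖z‖ ^ 2)⁻¹ * inner ℝ b a := by
    rw [cpd2, hev.fderiv_eq]
    refine (congrArg (fun L => L a) (h1.mul h2).fderiv).trans ?_
    simp [-Complex.inner]
  rw [h3, real_inner_comm a b]
  field_simp
  ring

open InnerProductSpace in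
theorem harmonicAt_log_norm {z : ℂ} (hz : z ≠ 0) : HarmonicAt (fun y : ℂ => Real.log ‖y‖) z :=
  AnalyticAt.harmonicAt_log_norm (f := fun y => y) analyticAt_id hz

open InnerProductSpace in
/-- Comparison with a logarithmic barrier in a domain with a small hole. -/
theorem abs_le_log_barrier {U : Set ℂ} (hUo : IsOpen U) (hUb : Bornology.IsBounded U)
    {ε R A B : ℝ} (hε : 0 < ε) (hεR : ε < R) (hB : 0 ≤ B) (hR : closedBall 0 R ⊆ U)
    {W : ℂ → ℝ} (hc : ContinuousOn W (closure (U \ closedBall 0 ε)))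
    (hW : HarmonicOnNhd W (U \ closedBall 0 ε))
    (hin : ∀ z : ℂ, ‖z‖ = ε → |W z| ≤ A) (hout : ∀ z ∈ frontier U, |W z| ≤ B + A) :
    ∀ z ∈ U \ closedBall 0 ε, |W z| ≤ A + B / Real.log (R / ε) * (Real.log ‖z‖ - Real.log ε) := by
  have hUo' : IsOpen (U \ closedBall 0 ε) := hUo.sdiff isClosed_closedBall
  have hnorm : ∀ z ∈ closure (U \ closedBall 0 ε), ε ≤ ‖z‖ := by
    have hcl : IsClosed {z : ℂ | ε ≤ ‖z‖} := isClosed_le continuous_const continuous_norm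
    intro z hz
    refine closure_minimal ?_ hcl hz
    rintro y ⟨-, hy⟩
    have : ε < ‖y‖ := by simpa using hy
    exact this.le
  have hlog : 0 < Real.log (R / ε) := Real.log_pos (by rwa [one_lt_div hε])
  set k := B / Real.log (R / ε) with hk
  have hk0 : 0 ≤ k := by positivity
  have hfront : ∀ z ∈ frontier (U \ closedBall 0 ε),
      |W z| ≤ A + k * (Real.log ‖z‖ - Real.log ε) := by
    intro z hz
    rw [hUo'.frontier_eq] at hz
    obtain ⟨hz1, hz2⟩ := hz
    have hεz := hnorm z hz1
    by_cases hzU : z ∈ U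
    · have hz3 : ‖z‖ = ε := by
        have : z ∈ closedBall 0 ε := by
          by_contra h
          exact hz2 ⟨hzU, h⟩
        exact le_antisymm (by simpa using this) hεz
      rw [hz3, sub_self, mul_zero, add_zero]
      exact hin z hz3
    · have hz3 : z ∈ frontier U := by
        rw [hUo.frontier_eq]
        exact ⟨closure_mono sdiff_subset hz1, hzU⟩
      have hz4 : R < ‖z‖ := by
        by_contra! h
        exact hzU (hR (by simpa using h))
      have h1 : Real.log (R / ε) ≤ Real.log ‖z‖ - Real.log ε := by
        rw [← Real.log_div (by linarith) hε.ne']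
        apply Real.log_le_log (by have := hε.trans hεR; positivity)
        gcongr
      have h2 : k * Real.log (R / ε) = B := by rw [hk]; field_simp
      have h3 : B ≤ k * (Real.log ‖z‖ - Real.log ε) := by
        rw [← h2]
        gcongr
      linarith [hout z hz3]
  have hmax : ∀ s : ℝ, |s| = 1 → ∀ z ∈ U \ closedBall 0 ε,
      s * W z - k * Real.log ‖z‖ ≤ A - k * Real.log ε := by
    intro s hs
    apply HarmonicOnNhd.le_of_frontier_le hUo' (hUb.subset sdiff_subset)
    · intro z hz
      have hz0 : z ≠ 0 := norm_pos_iff.1 (hε.trans_le (hnorm z (subset_closure hz)))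
      exact ((hW z hz).const_smul (c := s)).sub ((harmonicAt_log_norm hz0).const_smul (c := k))
    · refine (continuousOn_const.mul hc).sub (continuousOn_const.mul ?_)
      exact continuousOn_id.norm.log fun z hz => (hε.trans_le (hnorm z hz)).ne'
    · intro z hz
      have h1 := hfront z hz
      have h2 : s * W z ≤ |W z| := by
        have := le_abs_self (s * W z)
        rwa [abs_mul, hs, one_mul] at this
      linarith
  intro z hz
  rw [abs_le]
  have h1 := hmax 1 (by simp) z hz
  have h2 := hmax (-1) (by simp) z hz
  constructor <;> linarith

/-- Smallness conditions satisfied by the radius `ε` of the hole as `ε → 0`. -/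
theorem eventually_small_hole (C K η : ℝ) {R : ℝ} (hR : 0 < R) (hη : 0 < η) :
    ∀ᶠ ε in 𝓝[>] (0 : ℝ), ε < 1 ∧ |Real.log ε| * (C * ε) ≤ 1 ∧
      |Real.log ε| * (C * ε) + K * (Real.log 2 / Real.log (R / ε)) ≤ η := by
  have h1 : Tendsto (fun ε : ℝ => |Real.log ε| * (C * ε)) (𝓝[>] 0) (𝓝 0) := by
    have := (tendsto_log_mul_rpow_nhdsGT_zero one_pos).abs.const_mul C
    simp only [Real.rpow_one, abs_zero, mul_zero] at this
    refine this.congr' ?_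
    filter_upwards [self_mem_nhdsWithin] with ε hε
    rw [abs_mul, abs_of_pos (show (0 : ℝ) < ε from hε)]
    ring
  have h2 : Tendsto (fun ε : ℝ => Real.log (R / ε)) (𝓝[>] 0) atTop :=
    Real.tendsto_log_atTop.comp (tendsto_inv_nhdsGT_zero.const_mul_atTop hR)
  have h3 := h1.add ((h2.const_div_atTop (Real.log 2)).const_mul K)
  rw [mul_zero, add_zero] at h3
  filter_upwards [h1.eventually (ge_mem_nhds one_pos), h3.eventually (ge_mem_nhds hη),
    Ioo_mem_nhdsGT (one_pos : (0 : ℝ) < 1)] with ε h4 h5 h6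
  exact ⟨h6.2, h4, h5⟩

/-- Hessian expansion near the hole: for `C₀ε ≤ |x-x₀| ≤ ρ` and all `i, j`,
`∂²u_ε/∂xᵢ∂xⱼ = ∂²u₀/∂xᵢ∂xⱼ + (u₀(x₀)/(|log ε||x-x₀|²))(δᵢⱼ - 2(xᵢ-x₀ᵢ)(xⱼ-x₀ⱼ)/|x-x₀|²)
+ o(1/(|log ε||x-x₀|²))`. -/
theorem hess_uEps_expansion_near_hole
    (Ω : Set E2) (hΩo : IsOpen Ω) (hΩb : Bornology.IsBounded Ω) (hΩc : Convex ℝ Ω)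
    (u₀ : E2 → ℝ) (h₀ : IsTorsion Ω u₀)
    (x₀ : E2) (hx₀ : x₀ ∈ Ω)
    (ε₁ : ℝ) (hε₁ : 0 < ε₁) (hball : closedBall x₀ ε₁ ⊆ Ω)
    (uε : ℝ → E2 → ℝ)
    (huε : ∀ ε ∈ Ioo (0:ℝ) ε₁, IsTorsion (Ω \ closedBall x₀ ε) (uε ε)) :
    ∀ C₀ > 1, ∀ δ > 0, ∃ ρ > 0, ∃ ε₀ > 0, ε₀ ≤ ε₁ ∧ ∀ ε ∈ Ioo (0:ℝ) ε₀,
      ∀ x ∈ Ω \ closedBall x₀ ε, C₀ * ε ≤ ‖x - x₀‖ → ‖x - x₀‖ ≤ ρ →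
        ∀ i j : Fin 2,
          |Hess (uε ε) x i j - Hess u₀ x i j
              - (u₀ x₀ / (|Real.log ε| * ‖x - x₀‖ ^ 2)) *
                ((if i = j then 1 else 0)
                  - 2 * (x i - x₀ i) * (x j - x₀ j) / ‖x - x₀‖ ^ 2)|
            ≤ δ / (|Real.log ε| * ‖x - x₀‖ ^ 2) := by
  intro C₀ hC₀ δ hδ
  obtain ⟨h₀c, h₀d, h₀l, h₀f⟩ := h₀
  obtain ⟨C, hC, hCbound⟩ : ∃ C > 0, ∀ᶠ y in 𝓝 x₀, ‖u₀ y - u₀ x₀‖ ≤ C * ‖y - x₀‖ :=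
    (((h₀d x₀ hx₀).differentiableAt (by norm_num)).isBigO_sub).exists_pos.imp
      fun C h => ⟨h.1, h.2.bound⟩
  obtain ⟨τ, hτ, hCτ⟩ := Metric.eventually_nhds_iff.1 hCbound
  obtain ⟨D, hD⟩ := hΩb.subset_closedBall x₀
  set R := ε₁ with hRdef
  obtain ⟨c, hc, hc4, hcC⟩ : ∃ c : ℝ, 0 < c ∧ c ≤ 1 / 4 ∧ 1 + 4 * c ≤ C₀ :=
    ⟨min (1 / 4) ((C₀ - 1) / 4), lt_min (by norm_num) (by linarith), min_le_left _ _, by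
      linarith [min_le_right (1 / 4) ((C₀ - 1) / 4)]⟩
  set K := |u₀ x₀| * (|Real.log R| + |Real.log D|) + 1 with hK
  have hK0 : 0 < K := by positivity
  set ρ := min (R / 8) (δ * c * R / (640 * (K + 1))) with hρ
  obtain ⟨e, he, hesub⟩ := mem_nhdsGT_iff_exists_Ioo_subset.1
    (eventually_small_hole C K (δ * c ^ 3 / 160) hε₁ (by positivity))
  refine ⟨ρ, by positivity, min (min e τ) R, by have : 0 < e := he; positivity, min_le_right _ _, ?_⟩
  rintro ε ⟨hε, hεlt⟩ x ⟨hxΩ, hxε⟩ hxC hxρ i j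
  rw [lt_min_iff, lt_min_iff] at hεlt
  obtain ⟨⟨hεe, hετ⟩, hεR⟩ := hεlt
  obtain ⟨hε1, hsmall1, hsmall2⟩ := hesub ⟨hε, hεe⟩
  obtain ⟨hec, hed, hel, hef⟩ := huε ε ⟨hε, hεR⟩
  set u := uε ε with hu
  have hlogneg : Real.log ε < 0 := Real.log_neg hε hε1
  set L := |Real.log ε| with hL
  have hL0 : 0 < L := abs_pos.2 hlogneg.ne
  have hLε : Real.log ε = -L := by rw [hL, abs_of_neg hlogneg, neg_neg]
  set κ := u₀ x₀ / L with hκ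
  set h : ℂ ≃ₜ E2 := planeIso.toHomeomorph.trans (Homeomorph.addLeft x₀) with hh
  have hhz : ∀ z, h z = x₀ + planeIso z := fun z => rfl
  have hdist : ∀ z, ‖h z - x₀‖ = ‖z‖ := fun z => by simp [hhz]
  have hcb : ∀ r, h ⁻¹' closedBall x₀ r = closedBall 0 r := fun r => by
    ext z; simp [dist_eq_norm, hdist]
  set U := h ⁻¹' Ω with hU
  have hUε : U \ closedBall 0 ε = h ⁻¹' (Ω \ closedBall x₀ ε) := by
    rw [preimage_sdiff, hcb]
  have hUo : IsOpen U := hΩo.preimage h.continuous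
  have hUεo : IsOpen (U \ closedBall 0 ε) := hUo.sdiff isClosed_closedBall
  have hUb : Bornology.IsBounded U := by
    refine isBounded_closedBall.subset (?_ : U ⊆ closedBall 0 D)
    rw [← hcb]
    exact preimage_mono hD
  have hRU : closedBall 0 R ⊆ U := by
    rw [← hcb]
    exact preimage_mono hball
  have hhd : ContDiff ℝ 2 h :=
    contDiff_const.add planeIso.toContinuousLinearEquiv.contDiff
  set V : ℂ → ℝ := fun z => (u (h z) - u₀ (h z)) - κ * Real.log ‖z‖ with hV
  have hne : ∀ z ∈ U \ closedBall 0 ε, z ≠ 0 := by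
    rintro z ⟨-, hz⟩ rfl
    simp [hε.le] at hz
  have hud : ∀ z ∈ U \ closedBall 0 ε, ContDiffAt ℝ 2 (fun z => u (h z)) z := fun z hz =>
    (hed _ (by rw [hUε] at hz; exact hz)).comp z hhd.contDiffAt
  have hu₀d : ∀ z ∈ U \ closedBall 0 ε, ContDiffAt ℝ 2 (fun z => u₀ (h z)) z := fun z hz =>
    (h₀d _ hz.1).comp z hhd.contDiffAt
  have hlogd : ∀ z ∈ U \ closedBall 0 ε, ContDiffAt ℝ 2 (fun z : ℂ => κ * Real.log ‖z‖) z :=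
    fun z hz => contDiffAt_const.mul (harmonicAt_log_norm (hne z hz)).1
  have hVcpd2 : ∀ z ∈ U \ closedBall 0 ε, ∀ i j : Fin 2, cpd2 V z (cdir i) (cdir j)
      = pd2 u (h z) i j - pd2 u₀ (h z) i j - κ * (((if i = j then 1 else 0)
        - 2 * planeIso z i * planeIso z j / ‖z‖ ^ 2) / ‖z‖ ^ 2) := by
    intro z hz i j
    rw [hV, cpd2_sub ((hud z hz).sub (hu₀d z hz)) (hlogd z hz), cpd2_sub (hud z hz) (hu₀d z hz),
      cpd2_const_mul, cpd2_log_norm (hne z hz), hhz, pd2_eq_cpd2, pd2_eq_cpd2, inner_cdir,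
      ← planeIso_apply, ← planeIso_apply]
    rfl
  have hVh : InnerProductSpace.HarmonicOnNhd V (U \ closedBall 0 ε) := by
    refine harmonicOnNhd_of_cpd2 hUεo
      (fun z hz => ((hud z hz).sub (hu₀d z hz)).sub (hlogd z hz)) fun z hz => ?_
    have h00 := hVcpd2 z hz 0 0
    have h11 := hVcpd2 z hz 1 1
    have hl := hel (h z) (by rw [hUε] at hz; exact hz)
    have hl₀ := h₀l (h z) hz.1
    rw [lap] at hl hl₀
    have hnz : ‖z‖ ≠ 0 := norm_ne_zero_iff.2 (hne z hz)
    have hsq : ‖z‖ ^ 2 = planeIso z 0 ^ 2 + planeIso z 1 ^ 2 := by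
      rw [← planeIso.norm_map, EuclideanSpace.norm_sq_eq]
      simp
    have hsum : ((1 : ℝ) - 2 * planeIso z 0 * planeIso z 0 / ‖z‖ ^ 2) / ‖z‖ ^ 2
        + (1 - 2 * planeIso z 1 * planeIso z 1 / ‖z‖ ^ 2) / ‖z‖ ^ 2 = 0 := by
      field_simp
      linarith
    simp only [if_true] at h00 h11
    change cpd2 V z (cdir 0) (cdir 0) + cpd2 V z (cdir 1) (cdir 1) = 0
    rw [h00, h11]
    linear_combination hl - hl₀ - κ * hsum
  have hVc : ContinuousOn V (closure (U \ closedBall 0 ε)) := by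
    have hcl : closure (U \ closedBall 0 ε) = h ⁻¹' closure (Ω \ closedBall x₀ ε) := by
      rw [hUε, h.preimage_closure]
    refine ContinuousOn.sub (ContinuousOn.sub ?_ ?_) (continuousOn_const.mul ?_)
    · exact hec.comp h.continuous.continuousOn (by rw [hcl]; exact mapsTo_preimage _ _)
    · refine h₀c.comp h.continuous.continuousOn fun z hz => ?_
      rw [hcl] at hz
      exact closure_mono sdiff_subset hz
    · refine continuousOn_id.norm.log fun z hz => ?_
      have hcl' : closure (U \ closedBall 0 ε) ⊆ {z : ℂ | ε ≤ ‖z‖} := by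
        refine closure_minimal ?_ (isClosed_le continuous_const continuous_norm)
        rintro y ⟨-, hy⟩
        have : ε < ‖y‖ := by simpa using hy
        exact this.le
      exact (hε.trans_le (hcl' hz)).ne'
  have hufront : ∀ z ∈ closure (U \ closedBall 0 ε), z ∉ U \ closedBall 0 ε → u (h z) = 0 := by
    intro z hz hz'
    refine hef _ ?_
    have : z ∈ frontier (U \ closedBall 0 ε) := by rw [hUεo.frontier_eq]; exact ⟨hz, hz'⟩
    rwa [hUε, ← h.preimage_frontier] at this
  have hin : ∀ z : ℂ, ‖z‖ = ε → |V z| ≤ C * ε := by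
    intro z hz
    have hzU : z ∈ U := hRU (by simpa [hz] using hεR.le)
    have hzcl : z ∈ closure (U \ closedBall 0 ε) := by
      rw [sdiff_eq]
      refine hUo.inter_closure ⟨hzU, ?_⟩
      rw [closure_compl, interior_closedBall _ hε.ne']
      simp [hz]
    have hu0 := hufront z hzcl fun hz' => hz'.2 (by simp [hz])
    have h1 : V z = -(u₀ (h z) - u₀ x₀) := by
      simp only [hV, hu0, hz, hLε, hκ]
      field_simp
      ring
    have h2 := hCτ (y := h z) (by rw [dist_eq_norm, hdist, hz]; exact hετ)
    rw [hdist, hz, Real.norm_eq_abs] at h2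
    rwa [h1, abs_neg]
  have hout : ∀ z ∈ frontier U, |V z| ≤ K / L + C * ε := by
    intro z hz
    have hzΩ : h z ∈ frontier Ω := by rwa [hU, ← h.preimage_frontier] at hz
    rw [hUo.frontier_eq] at hz
    have hzR : R < ‖z‖ := by
      by_contra! hle
      exact hz.2 (hRU (by simpa using hle))
    have hzcl : z ∈ closure (U \ closedBall 0 ε) :=
      isClosed_closedBall.isOpen_compl.closure_inter ⟨hz.1, by simp; linarith⟩
    have hu0 := hufront z hzcl fun hz' => hz.2 hz'.1
    have hzD : ‖z‖ ≤ D := by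
      have := closure_minimal hD isClosed_closedBall (frontier_subset_closure hzΩ)
      rwa [mem_closedBall, dist_eq_norm, hdist] at this
    have hlog : |Real.log ‖z‖| ≤ |Real.log R| + |Real.log D| := by
      have h1 : Real.log R ≤ Real.log ‖z‖ := Real.log_le_log hε₁ hzR.le
      have h2 : Real.log ‖z‖ ≤ Real.log D := Real.log_le_log (by linarith) hzD
      rw [abs_le]
      constructor
      · linarith [neg_abs_le (Real.log R), abs_nonneg (Real.log D)]
      · linarith [le_abs_self (Real.log D), abs_nonneg (Real.log R)]
    have h1 : |V z| = |u₀ x₀| * |Real.log ‖z‖| / L := by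
      simp only [hV, hu0, h₀f _ hzΩ, hκ]
      rw [sub_self, zero_sub, abs_neg, abs_mul, abs_div, abs_of_pos hL0]
      ring
    have h2 : |V z| ≤ K / L := by
      rw [h1]
      gcongr
      rw [hK]
      linarith [mul_le_mul_of_nonneg_left hlog (abs_nonneg (u₀ x₀))]
    have : 0 < C * ε := by positivity
    linarith
  have hbarrier := abs_le_log_barrier hUo hUb hε hεR (by positivity : 0 ≤ K / L) hRU hVc hVh
    hin hout
  have hlogRε : 0 < Real.log (R / ε) := Real.log_pos (by rwa [one_lt_div hε])
  have hann : ∀ z : ℂ, ε < ‖z‖ → ‖z‖ < R → z ∈ U \ closedBall 0 ε := fun z h1 h2 =>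
    ⟨hRU (by simpa using h2.le), by simpa using h1⟩
  have hlog2 : 0 < Real.log 2 := Real.log_pos (by norm_num)
  set S := C * ε + K / L / Real.log (R / ε) * Real.log 2 with hS
  set T := C * ε + K / L with hT
  obtain ⟨z, rfl⟩ := h.surjective x
  have hzU : z ∈ U \ closedBall 0 ε := by rw [hUε]; exact ⟨hxΩ, hxε⟩
  have hz0 : 0 < ‖z‖ := norm_pos_iff.2 (hne z hzU)
  rw [hdist] at hxC hxρ ⊢
  have hzR : ‖z‖ ≤ R / 8 := hxρ.trans (min_le_left _ _)
  have hVS : ∀ y : ℂ, ε < ‖y‖ → ‖y‖ ≤ 2 * ε → |V y| ≤ S := by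
    intro y h1 h2
    have hyR : ‖y‖ < R := by
      have : ε ≤ C₀ * ε := by nlinarith
      linarith
    refine (hbarrier y (hann y h1 hyR)).trans ?_
    rw [hS]
    gcongr
    rw [← Real.log_div (by linarith) hε.ne']
    exact Real.log_le_log (div_pos (by linarith) hε) (by rwa [div_le_iff₀ hε])
  have hVT : ∀ y : ℂ, ε < ‖y‖ → ‖y‖ < R → |V y| ≤ T := by
    intro y h1 h2
    refine (hbarrier y (hann y h1 h2)).trans ?_
    have h3 : Real.log ‖y‖ - Real.log ε ≤ Real.log (R / ε) := by
      rw [Real.log_div hε₁.ne' hε.ne']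
      linarith [Real.log_le_log (by linarith) h2.le]
    calc _ ≤ C * ε + K / L / Real.log (R / ε) * Real.log (R / ε) := by gcongr
      _ = T := by rw [hT]; field_simp
  have hderiv := norm_deriv_complexPartial_le hc hc4 hε (by positivity : 0 < S)
    (by positivity : 0 < T) (fun y hy => hVh y (hann y hy.1 hy.2)) hVS hVT
    ((mul_le_mul_of_nonneg_right hcC hε.le).trans hxC) hzR
  have hexpr : Hess u (h z) i j - Hess u₀ (h z) i j - (u₀ x₀ / (L * ‖z‖ ^ 2)) *
      ((if i = j then 1 else 0) - 2 * (h z i - x₀ i) * (h z j - x₀ j) / ‖z‖ ^ 2)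
      = cpd2 V z (cdir i) (cdir j) := by
    have hcoord : ∀ k, h z k - x₀ k = planeIso z k := fun k => by simp [hhz]
    rw [hVcpd2 z hzU, hcoord, hcoord, Hess, Hess, Matrix.of_apply, Matrix.of_apply, hκ]
    field_simp
  rw [hexpr]
  refine ((abs_cpd2_le (hVh z hzU) i j).trans hderiv).trans ?_
  rw [div_le_div_iff₀ (by positivity) (by positivity)]
  have hLT : L * T ≤ K + 1 := by
    have : L * T = L * (C * ε) + K := by rw [hT]; field_simp
    linarith
  have hLS : L * S ≤ δ * c ^ 3 / 160 := by
    have : L * S = L * (C * ε) + K * (Real.log 2 / Real.log (R / ε)) := by rw [hS]; field_simp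
    linarith
  have hzρ : ‖z‖ * (640 * (K + 1)) ≤ δ * c * R := by
    rw [← le_div_iff₀ (by positivity)]
    exact hxρ.trans (min_le_right _ _)
  calc (80 * T / R + 20 * S / (c ^ 2 * ‖z‖)) * (L * ‖z‖ ^ 2)
      = 80 * ‖z‖ ^ 2 / R * (L * T) + 20 * ‖z‖ / c ^ 2 * (L * S) := by field_simp
    _ ≤ 80 * ‖z‖ ^ 2 / R * (K + 1) + 20 * ‖z‖ / c ^ 2 * (δ * c ^ 3 / 160) := by gcongr
    _ = ‖z‖ / (8 * R) * (‖z‖ * (640 * (K + 1))) + δ * (c * ‖z‖ / 8) := by field_simp; ring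
    _ ≤ ‖z‖ / (8 * R) * (δ * c * R) + δ * (c * ‖z‖ / 8) := by gcongr
    _ = δ * (c * ‖z‖ / 4) := by field_simp; ring
end
end

section
/- There exist θ > 1 and ε₀ > 0 such that for all ε ∈ (0, ε₀) and all x ∈ Ω_ε with ε < |x − x₀| ≤ θ·ε, one has |∇u_ε(x)| ≥ u₀(x₀)/(8·ε·|log ε|). -/
open Real Set Metric Filter Topology

noncomputable section

/-- `u` is `C²` at `x` and its Laplacian there is `l`. -/
def HasLap (u : E2 → ℝ) (x : E2) (l : ℝ) : Prop := ContDiffAt ℝ 2 u x ∧ lap u x = l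

lemma ContDiffAt.differentiableAt_fderiv_of_two {u : E2 → ℝ} {x : E2} (h : ContDiffAt ℝ 2 u x) :
    DifferentiableAt ℝ (fderiv ℝ u) x :=
  (h.fderiv_right (m := 1) (by norm_num)).differentiableAt (by norm_num)

lemma ContDiffAt.eventually_differentiableAt_of_two {u : E2 → ℝ} {x : E2}
    (h : ContDiffAt ℝ 2 u x) : ∀ᶠ y in 𝓝 x, DifferentiableAt ℝ u y :=
  (h.eventually (by simp)).mono fun _ hy => hy.differentiableAt (by norm_num)

lemma pd2_eq_fderiv_fderiv {u : E2 → ℝ} {x : E2} (h : ContDiffAt ℝ 2 u x) (i j : Fin 2) :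
    pd2 u x i j =
      fderiv ℝ (fderiv ℝ u) x (EuclideanSpace.single i 1) (EuclideanSpace.single j 1) := by
  unfold pd2
  rw [fderiv_clm_apply h.differentiableAt_fderiv_of_two (by fun_prop)]
  simp

lemma lap_eq_of_eventuallyEq {u : E2 → ℝ} {x : E2} {g : Fin 2 → E2 → ℝ} {w : Fin 2 → E2 →L[ℝ] ℝ}
    (hg : ∀ i, ∀ᶠ y in 𝓝 x, fderiv ℝ u y (EuclideanSpace.single i 1) = g i y)
    (hw : ∀ i, HasFDerivAt (g i) (w i) x) :
    lap u x = w 0 (EuclideanSpace.single 0 1) + w 1 (EuclideanSpace.single 1 1) := by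
  have key : ∀ i, fderiv ℝ (fun y => fderiv ℝ u y (EuclideanSpace.single i 1)) x = w i := by
    intro i
    rw [Filter.EventuallyEq.fderiv_eq (hg i)]
    exact (hw i).fderiv
  simp only [lap, pd2, key]

namespace HasLap

variable {u v : E2 → ℝ} {x : E2} {a b : ℝ}

lemma add (hu : HasLap u x a) (hv : HasLap v x b) : HasLap (fun y => u y + v y) x (a + b) := by
  obtain ⟨hu, rfl⟩ := hu
  obtain ⟨hv, rfl⟩ := hv
  have hs : ContDiffAt ℝ 2 (fun y => u y + v y) x := hu.add hv
  have h2 : fderiv ℝ (fun y => u y + v y) =ᶠ[𝓝 x] fun y => fderiv ℝ u y + fderiv ℝ v y := by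
    filter_upwards [hu.eventually_differentiableAt_of_two,
      hv.eventually_differentiableAt_of_two] with y h1 h2
    exact fderiv_add h1 h2
  refine ⟨hs, ?_⟩
  simp only [lap, pd2_eq_fderiv_fderiv hs, pd2_eq_fderiv_fderiv hu, pd2_eq_fderiv_fderiv hv]
  rw [h2.fderiv_eq, fderiv_fun_add hu.differentiableAt_fderiv_of_two
    hv.differentiableAt_fderiv_of_two]
  simp only [add_apply]
  ring

lemma const_mul (c : ℝ) (hu : HasLap u x a) : HasLap (fun y => c * u y) x (c * a) := by
  obtain ⟨hu, rfl⟩ := hu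
  have hs : ContDiffAt ℝ 2 (fun y => c * u y) x := contDiffAt_const.mul hu
  have h2 : fderiv ℝ (fun y => c * u y) =ᶠ[𝓝 x] fun y => c • fderiv ℝ u y := by
    filter_upwards [hu.eventually_differentiableAt_of_two] with y h1
    exact fderiv_const_mul h1 c
  refine ⟨hs, ?_⟩
  simp only [lap, pd2_eq_fderiv_fderiv hs, pd2_eq_fderiv_fderiv hu]
  rw [h2.fderiv_eq, fderiv_fun_const_smul hu.differentiableAt_fderiv_of_two]
  simp only [smul_apply, smul_eq_mul]
  ring

lemma sub (hu : HasLap u x a) (hv : HasLap v x b) : HasLap (fun y => u y - v y) x (a - b) := by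
  simpa [sub_eq_add_neg] using hu.add (hv.const_mul (-1))

/-- Laplacian of a quadratic polynomial in one linear form. -/
lemma quadratic (l : E2 →L[ℝ] ℝ) (A B C : ℝ) (x : E2) :
    HasLap (fun z => A * l z ^ 2 + B * l z + C) x
      (2 * A * (l (EuclideanSpace.single 0 1) ^ 2 + l (EuclideanSpace.single 1 1) ^ 2)) := by
  refine ⟨by fun_prop, ?_⟩
  rw [lap_eq_of_eventuallyEq
    (g := fun i y => (2 * A * l y + B) * l (EuclideanSpace.single i 1))
    (w := fun i => (l (EuclideanSpace.single i 1)) • ((2 * A) • l))]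
  · simp; ring
  · intro i
    refine Eventually.of_forall fun y => ?_
    have h : HasFDerivAt (fun z => A * l z ^ 2 + B * l z + C) _ y :=
      (((l.hasFDerivAt.pow 2).const_mul A).add (l.hasFDerivAt.const_mul B)).add_const C
    rw [h.fderiv]
    simp; ring
  · intro i
    exact ((l.hasFDerivAt.const_mul (2 * A)).add_const B).mul_const _

lemma const (c : ℝ) (x : E2) : HasLap (fun _ => c) x 0 := by
  simpa using quadratic 0 0 0 c x

lemma comp_dilation {c : E2} {t : ℝ} (hu : HasLap u (c + t • (x - c)) a) :
    HasLap (fun y => u (c + t • (y - c))) x (t ^ 2 * a) := by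
  obtain ⟨hu, rfl⟩ := hu
  have hT : ∀ y, HasFDerivAt (fun y : E2 => c + t • (y - c)) (t • ContinuousLinearMap.id ℝ E2) y :=
    fun y => (((hasFDerivAt_id y).sub_const c).const_smul t).const_add c
  refine ⟨hu.comp (g := u) x (by fun_prop), ?_⟩
  rw [lap_eq_of_eventuallyEq
    (g := fun i y => t * fderiv ℝ u (c + t • (y - c)) (EuclideanSpace.single i 1))
    (w := fun i => t • ((fderiv ℝ (fun y => fderiv ℝ u y (EuclideanSpace.single i 1))
      (c + t • (x - c))).comp (t • ContinuousLinearMap.id ℝ E2)))]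
  · simp [lap, pd2]; ring
  · intro i
    have hc : ContinuousAt (fun y : E2 => c + t • (y - c)) x := by fun_prop
    filter_upwards [hc.eventually hu.eventually_differentiableAt_of_two] with y hy
    have := (hy.hasFDerivAt.comp y (hT y)).fderiv
    simp only [Function.comp_def] at this
    rw [this]
    simp
  · intro i
    have hd : DifferentiableAt ℝ (fun y => fderiv ℝ u y (EuclideanSpace.single i 1))
        (c + t • (x - c)) := hu.differentiableAt_fderiv_of_two.clm_apply (by fun_prop)
    exact (hd.hasFDerivAt.comp x (hT x)).const_mul t

lemma log_norm_sub {c : E2} (hx : x ≠ c) : HasLap (fun y => Real.log ‖y - c‖) x 0 := by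
  have hsq : ∀ y : E2, ‖y - c‖ ^ 2 = (y 0 - c 0) ^ 2 + (y 1 - c 1) ^ 2 := by
    intro y
    simp [EuclideanSpace.norm_sq_eq]
  have hlog : (fun y : E2 => Real.log ‖y - c‖)
      = fun y => 1 / 2 * Real.log ((y 0 - c 0) ^ 2 + (y 1 - c 1) ^ 2) := by
    funext y
    rw [← hsq, Real.log_pow]
    push_cast; ring
  have hne : ∀ y : E2, y ≠ c → (y 0 - c 0) ^ 2 + (y 1 - c 1) ^ 2 ≠ 0 := fun y hy => by
    rw [← hsq]
    exact pow_ne_zero 2 (norm_ne_zero_iff.mpr (sub_ne_zero.mpr hy))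
  have hp : ∀ (i : Fin 2) (y : E2), HasFDerivAt (fun y : E2 => y i - c i)
      (EuclideanSpace.proj i : E2 →L[ℝ] ℝ) y := fun i y =>
    (EuclideanSpace.proj i : E2 →L[ℝ] ℝ).hasFDerivAt.sub_const (c i)
  have hq : ∀ y : E2, HasFDerivAt (fun y : E2 => (y 0 - c 0) ^ 2 + (y 1 - c 1) ^ 2) _ y :=
    fun y => ((hp 0 y).pow 2).add ((hp 1 y).pow 2)
  refine ⟨((contDiffAt_id.sub contDiffAt_const).norm ℝ (sub_ne_zero.mpr hx)).log
    (norm_ne_zero_iff.mpr (sub_ne_zero.mpr hx)), ?_⟩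
  rw [hlog, lap_eq_of_eventuallyEq
    (g := fun i y => (y i - c i) * ((y 0 - c 0) ^ 2 + (y 1 - c 1) ^ 2)⁻¹)]
  rotate_left 2
  · intro i
    exact (hp i x).mul ((hasDerivAt_inv (hne x hx)).comp_hasFDerivAt x (hq x))
  · have := hne x hx
    simp
    field_simp
    ring
  · intro i
    filter_upwards [isOpen_ne.mem_nhds hx] with y hy
    have h := ((hq y).log (hne y hy)).const_mul (1 / 2)
    rw [h.fderiv]
    have := hne y hy
    fin_cases i <;> simp <;> field_simp

end HasLap

lemma IsLocalMin.pd2_self_nonneg {u : E2 → ℝ} {x : E2} (hu : ContDiffAt ℝ 2 u x)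
    (hmin : IsLocalMin u x) (i : Fin 2) : 0 ≤ pd2 u x i i := by
  set e : E2 := EuclideanSpace.single i 1
  have hl : ∀ s : ℝ, HasDerivAt (fun s : ℝ => x + s • e) e s := fun s => by
    simpa using ((hasDerivAt_id s).smul_const e).const_add x
  have hc : Tendsto (fun s : ℝ => x + s • e) (𝓝 0) (𝓝 x) := by
    have := (hl 0).continuousAt.tendsto
    simpa using this
  have hd : deriv (fun s : ℝ => u (x + s • e)) =ᶠ[𝓝 0] fun s => fderiv ℝ u (x + s • e) e := by
    filter_upwards [hc.eventually hu.eventually_differentiableAt_of_two] with s hs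
    exact (hs.hasFDerivAt.comp_hasDerivAt s (hl s)).deriv
  have hdd : deriv (deriv (fun s : ℝ => u (x + s • e))) 0 = pd2 u x i i := by
    rw [hd.deriv_eq]
    have hdiff : DifferentiableAt ℝ (fun y => fderiv ℝ u y e) (x + (0 : ℝ) • e) := by
      simpa using hu.differentiableAt_fderiv_of_two.clm_apply (differentiableAt_const e)
    have := (hdiff.hasFDerivAt.comp_hasDerivAt (0 : ℝ) (hl 0)).deriv
    simpa [Function.comp_def, pd2] using this
  have hmin' : IsLocalMin (fun s : ℝ => u (x + s • e)) 0 := by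
    have := hc.eventually hmin
    simpa [IsLocalMin, IsMinFilter] using this
  by_contra! hneg
  rw [← hdd] at hneg
  have hcont : ContinuousAt (fun s : ℝ => u (x + s • e)) 0 :=
    ContinuousAt.comp (g := u) (by simpa using hu.continuousAt) (hl 0).continuousAt
  have hmax := isLocalMax_of_deriv_deriv_neg hneg hmin'.deriv_eq_zero hcont
  have hconst : (fun s : ℝ => u (x + s • e)) =ᶠ[𝓝 0] fun _ => u (x + (0 : ℝ) • e) := by
    filter_upwards [hmin', hmax] with s h1 h2
    exact le_antisymm h2 h1
  rw [hconst.deriv.deriv_eq] at hneg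
  simp at hneg

/-- Weak minimum principle for superharmonic `C²` functions. -/
theorem nonneg_of_lap_nonpos {U : Set E2} (hU : IsOpen U) (hb : Bornology.IsBounded U)
    {f : E2 → ℝ} (hf : ContinuousOn f (closure U))
    (hlap : ∀ x ∈ U, ∃ l ≤ 0, HasLap f x l) (hfr : ∀ x ∈ frontier U, 0 ≤ f x) :
    ∀ x ∈ closure U, 0 ≤ f x := by
  intro x hx
  by_contra! hneg
  have hK : IsCompact (closure U) := hb.isCompact_closure
  let p : E2 →L[ℝ] ℝ := EuclideanSpace.proj 0
  obtain ⟨M, hM⟩ := (hK.image_of_continuousOn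
    (f := fun z => p z ^ 2) (by fun_prop)).isBounded.subset_closedBall 0
  have hM' : ∀ z ∈ closure U, p z ^ 2 ≤ M := fun z hz => by
    have := hM (mem_image_of_mem _ hz)
    simpa using this
  have hM0 : 0 ≤ M := (sq_nonneg _).trans (hM' x hx)
  set δ : ℝ := -f x / (2 * (M + 1))
  have hδ : 0 < δ := by apply div_pos <;> linarith
  have hδM : δ * M < -f x := by
    have : δ * (M + 1) = -f x / 2 := by simp only [δ]; field_simp
    nlinarith
  obtain ⟨y, hy, hymin⟩ := hK.exists_isMinOn ⟨x, hx⟩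
    (f := fun z => f z - δ * p z ^ 2) (by fun_prop)
  have hyx : f y - δ * p y ^ 2 ≤ f x - δ * p x ^ 2 := hymin hx
  have hyU : y ∈ U := by
    by_contra hyU
    have h1 := hfr y ⟨hy, by rwa [hU.interior_eq]⟩
    have h2 := mul_le_mul_of_nonneg_left (hM' y hy) hδ.le
    have h3 := mul_nonneg hδ.le (sq_nonneg (p x))
    linarith
  obtain ⟨l, hl, hfl⟩ := hlap y hyU
  have hg := hfl.sub (HasLap.quadratic p δ 0 0 y)
  simp only [zero_mul, add_zero] at hg
  have hloc : IsLocalMin (fun z => f z - δ * p z ^ 2) y :=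
    hymin.isLocalMin (mem_of_superset (hU.mem_nhds hyU) subset_closure)
  have h0 := hloc.pd2_self_nonneg hg.1 0
  have h1 := hloc.pd2_self_nonneg hg.1 1
  have h2 := hg.2
  simp only [lap] at h2
  simp [p] at h2
  simp [p] at h0 h1
  linarith

section Perforated

variable {Ω : Set E2} {c : E2} {ε R : ℝ} {u : E2 → ℝ}

lemma IsTorsion.hasLap {U : Set E2} (h : IsTorsion U u) {x : E2} (hx : x ∈ U) :
    HasLap u x (-1) := ⟨h.2.1 x hx, h.2.2.1 x hx⟩

lemma isOpen_diff_closedBall (hΩ : IsOpen Ω) : IsOpen (Ω \ closedBall c ε) :=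
  hΩ.sdiff isClosed_closedBall

lemma le_norm_sub_of_mem_closure {x : E2} (hx : x ∈ closure (Ω \ closedBall c ε)) :
    ε ≤ ‖x - c‖ := by
  have hcl : IsClosed {y : E2 | ε ≤ ‖y - c‖} := isClosed_le (by fun_prop) (by fun_prop)
  refine closure_minimal (fun y hy => ?_) hcl hx
  have := hy.2
  rw [mem_closedBall_iff_norm, not_le] at this
  exact this.le

lemma frontier_diff_closedBall_subset (hΩ : IsOpen Ω) :
    frontier (Ω \ closedBall c ε) ⊆ frontier Ω ∪ {x | ‖x - c‖ = ε} := by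
  intro x hx
  rw [(isOpen_diff_closedBall hΩ).frontier_eq] at hx
  by_cases hxΩ : x ∈ Ω
  · right
    have h1 : x ∈ closedBall c ε := by
      by_contra h
      exact hx.2 ⟨hxΩ, h⟩
    exact le_antisymm (mem_closedBall_iff_norm.mp h1) (le_norm_sub_of_mem_closure hx.1)
  · left
    rw [hΩ.frontier_eq]
    exact ⟨closure_mono sdiff_subset hx.1, hxΩ⟩

lemma frontier_subset_frontier_diff_closedBall (hΩ : IsOpen Ω) (hB : closedBall c ε ⊆ Ω) :
    frontier Ω ⊆ frontier (Ω \ closedBall c ε) := by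
  intro x hx
  rw [hΩ.frontier_eq] at hx
  rw [(isOpen_diff_closedBall hΩ).frontier_eq]
  refine ⟨?_, fun h => hx.2 h.1⟩
  have := (isClosed_closedBall (x := c) (ε := ε)).isOpen_compl.inter_closure (t := Ω)
    ⟨fun h => hx.2 (hB h), hx.1⟩
  rwa [inter_comm] at this

lemma mem_frontier_diff_closedBall_of_norm_eq (hΩ : IsOpen Ω) (hB : closedBall c ε ⊆ Ω)
    (hε : 0 < ε) {x : E2} (hx : ‖x - c‖ = ε) : x ∈ frontier (Ω \ closedBall c ε) := by
  have hxB : x ∈ closedBall c ε := mem_closedBall_iff_norm.mpr hx.le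
  rw [(isOpen_diff_closedBall hΩ).frontier_eq]
  refine ⟨?_, fun h => h.2 hxB⟩
  have hT : ContinuousAt (fun t : ℝ => c + t • (x - c)) 1 := by fun_prop
  have hT1 : c + (1 : ℝ) • (x - c) = x := by simp
  refine mem_closure_of_tendsto (f := fun t : ℝ => c + t • (x - c)) (b := 𝓝[>] (1 : ℝ)) ?_ ?_
  · have := hT.tendsto
    rw [hT1] at this
    exact this.mono_left nhdsWithin_le_nhds
  · have h1 : ∀ᶠ t in 𝓝[>] (1 : ℝ), c + t • (x - c) ∈ Ω :=
      nhdsWithin_le_nhds (hT.eventually (hΩ.mem_nhds (by simpa using hB hxB)))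
    filter_upwards [h1, self_mem_nhdsWithin] with t ht1 ht2
    refine ⟨ht1, ?_⟩
    have ht2' : (1 : ℝ) < t := ht2
    rw [mem_closedBall_iff_norm, add_sub_cancel_left, norm_smul, hx,
      Real.norm_of_nonneg (by linarith), not_le]
    nlinarith

lemma continuousOn_log_norm_sub {s : Set E2} (hs : ∀ x ∈ s, 0 < ‖x - c‖) :
    ContinuousOn (fun y => Real.log ‖y - c‖) s :=
  ContinuousOn.log (by fun_prop) fun x hx => (hs x hx).ne'

lemma ne_of_norm_sub_pos {x : E2} (hx : 0 < ‖x - c‖) : x ≠ c :=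
  sub_ne_zero.mp (norm_pos_iff.mp hx)

lemma norm_sub_of_mem_diff {x : E2} (hx : x ∈ Ω \ closedBall c ε) : ε < ‖x - c‖ := by
  have := hx.2
  rwa [mem_closedBall_iff_norm, not_le] at this

/-- Removing a small disc lowers the torsion function by at most a logarithmic potential. -/
lemma IsTorsion.sub_log_le (hΩ : IsOpen Ω) (hb : Bornology.IsBounded Ω) {u₀ : E2 → ℝ}
    (h₀ : IsTorsion Ω u₀) (hu : IsTorsion (Ω \ closedBall c ε) u) (hε : 0 < ε)
    {M D : ℝ} (hM0 : 0 ≤ M) (hM : ∀ x ∈ closure Ω, u₀ x ≤ M)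
    (hD : ∀ x ∈ closure Ω, ‖x - c‖ ≤ D) (hεD : ε < D) {x : E2}
    (hx : x ∈ closure (Ω \ closedBall c ε)) :
    u₀ x - M / (Real.log D - Real.log ε) * (Real.log D - Real.log ‖x - c‖) ≤ u x := by
  have hL : 0 < Real.log D - Real.log ε := sub_pos.mpr (Real.log_lt_log hε hεD)
  set k := M / (Real.log D - Real.log ε)
  have hk : 0 ≤ k := div_nonneg hM0 hL.le
  have hpos : ∀ y ∈ closure (Ω \ closedBall c ε), 0 < ‖y - c‖ := fun y hy =>
    hε.trans_le (le_norm_sub_of_mem_closure hy)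
  have key := nonneg_of_lap_nonpos (isOpen_diff_closedBall hΩ) (hb.subset sdiff_subset)
    (f := fun y => (u y - u₀ y) + (k * Real.log D - k * Real.log ‖y - c‖))
    ((hu.1.sub (h₀.1.mono (closure_mono sdiff_subset))).add
      (continuousOn_const.sub (continuousOn_const.mul (continuousOn_log_norm_sub hpos))))
    (fun y hy => ⟨_, by norm_num, ((hu.hasLap hy).sub (h₀.hasLap hy.1)).add
      ((HasLap.const _ y).sub ((HasLap.log_norm_sub
        (ne_of_norm_sub_pos (hpos y (subset_closure hy)))).const_mul k))⟩)
    (fun y hy => ?_) x hx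
  · linarith
  · have hcl := frontier_subset_closure hy
    have hclΩ := closure_mono sdiff_subset hcl
    rw [hu.2.2.2 y hy]
    rcases frontier_diff_closedBall_subset hΩ hy with h | h
    · rw [h₀.2.2.2 y h]
      have := mul_le_mul_of_nonneg_left (Real.log_le_log (hpos y hcl) (hD y hclΩ)) hk
      linarith
    · have h' : ‖y - c‖ = ε := h
      have := hM y hclΩ
      have hkL : k * (Real.log D - Real.log ε) = M := div_mul_cancel₀ M hL.ne'
      rw [h']
      linarith

/-- Logarithmic lower bound for the torsion function in an annulus around the hole. -/
lemma IsTorsion.log_le (hΩ : IsOpen Ω) (hu : IsTorsion (Ω \ closedBall c ε) u) (hε : 0 < ε)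
    (hεR : ε < R) (hB : closedBall c R ⊆ Ω) {m : ℝ} (hm : ∀ x, ‖x - c‖ = R → m ≤ u x) {x : E2}
    (hx : ε ≤ ‖x - c‖) (hxR : ‖x - c‖ ≤ R) :
    m / (Real.log R - Real.log ε) * (Real.log ‖x - c‖ - Real.log ε) ≤ u x := by
  have hL : 0 < Real.log R - Real.log ε := sub_pos.mpr (Real.log_lt_log hε hεR)
  have hBε : closedBall c ε ⊆ Ω := (closedBall_subset_closedBall hεR.le).trans hB
  set k := m / (Real.log R - Real.log ε)
  have hkL : k * (Real.log R - Real.log ε) = m := div_mul_cancel₀ m hL.ne'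
  have h1 : ∀ y, ‖y - c‖ = ε → k * (Real.log ‖y - c‖ - Real.log ε) ≤ u y := fun y hy => by
    rw [hu.2.2.2 y (mem_frontier_diff_closedBall_of_norm_eq hΩ hBε hε hy), hy]
    simp
  have h2 : ∀ y, ‖y - c‖ = R → k * (Real.log ‖y - c‖ - Real.log ε) ≤ u y := fun y hy => by
    rw [hy, hkL]
    exact hm y hy
  rcases hx.eq_or_lt with hx' | hx'
  · exact h1 x hx'.symm
  rcases hxR.eq_or_lt with hxR' | hxR'
  · exact h2 x hxR'
  have hsub : ball c R \ closedBall c ε ⊆ Ω \ closedBall c ε :=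
    sdiff_subset_sdiff_left (ball_subset_closedBall.trans hB)
  have hpos : ∀ y ∈ closure (ball c R \ closedBall c ε), 0 < ‖y - c‖ := fun y hy =>
    hε.trans_le (le_norm_sub_of_mem_closure hy)
  have key := nonneg_of_lap_nonpos (isOpen_diff_closedBall isOpen_ball)
    (isBounded_ball.subset sdiff_subset)
    (f := fun y => u y - (k * Real.log ‖y - c‖ - k * Real.log ε))
    ((hu.1.mono (closure_mono hsub)).sub
      ((continuousOn_const.mul (continuousOn_log_norm_sub hpos)).sub continuousOn_const))
    (fun y hy => ⟨_, by norm_num, (hu.hasLap (hsub hy)).sub (((HasLap.log_norm_sub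
        (ne_of_norm_sub_pos (hpos y (subset_closure hy)))).const_mul k).sub
          (HasLap.const _ y))⟩)
    (fun y hy => ?_) x (subset_closure ⟨mem_ball_iff_norm.mpr hxR', by
      rw [mem_closedBall_iff_norm, not_le]; exact hx'⟩)
  · linarith
  · rcases frontier_diff_closedBall_subset isOpen_ball hy with h | h
    · have := h2 y (mem_sphere_iff_norm.mp (frontier_ball_subset_sphere h))
      linarith
    · have := h1 y h
      linarith

/-- Linear decay of the torsion function at the outer boundary of a convex set. -/
lemma IsTorsion.le_mul_norm_sub (hΩ : IsOpen Ω) (hb : Bornology.IsBounded Ω) (hc : Convex ℝ Ω)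
    (hu : IsTorsion (Ω \ closedBall c ε) u) {D : ℝ}
    (hD : ∀ a ∈ closure Ω, ∀ b ∈ closure Ω, ‖a - b‖ ≤ D) {x y : E2} (hy : y ∈ frontier Ω)
    (hx : x ∈ closure (Ω \ closedBall c ε)) : u x ≤ D / 2 * ‖y - x‖ := by
  rw [hΩ.frontier_eq] at hy
  obtain ⟨f, hf⟩ := geometric_hahn_banach_open_point hc hΩ hy.2
  obtain ⟨z₀, hz₀⟩ : Ω.Nonempty := closure_nonempty_iff.mp ⟨y, hy.1⟩
  have hf0 : f ≠ 0 := by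
    rintro rfl
    simpa using hf z₀ hz₀
  have hn : 0 < ‖f‖ := norm_pos_iff.mpr hf0
  set l : E2 →L[ℝ] ℝ := ‖f‖⁻¹ • f with hl
  have hl1 : ‖l‖ = 1 := by
    rw [hl, norm_smul, norm_inv, norm_norm, inv_mul_cancel₀ hn.ne']
  have hle : l (EuclideanSpace.single 0 1) ^ 2 + l (EuclideanSpace.single 1 1) ^ 2 = 1 := by
    set n := (InnerProductSpace.toDual ℝ E2).symm l with hndef
    have h1 : ∀ i : Fin 2, l (EuclideanSpace.single i 1) = n i := fun i => by
      rw [← InnerProductSpace.toDual_symm_apply (x := EuclideanSpace.single i 1), ← hndef,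
        EuclideanSpace.inner_single_right]
      simp
    have h2 : ‖n‖ = 1 := by rw [hndef, LinearIsometryEquiv.norm_map, hl1]
    have h3 := EuclideanSpace.norm_sq_eq n
    rw [h2] at h3
    simp at h3
    rw [h1, h1, ← h3]
  have hnn : ∀ z ∈ closure Ω, 0 ≤ l y - l z := by
    intro z hz
    have hcl : IsClosed {z : E2 | l z ≤ l y} := isClosed_le (by fun_prop) (by fun_prop)
    have : z ∈ {z : E2 | l z ≤ l y} := closure_minimal (fun w hw => by
      have := mul_le_mul_of_nonneg_left (hf w hw).le (inv_nonneg.mpr hn.le)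
      simpa [hl] using this) hcl hz
    exact sub_nonneg.mpr this
  have hle' : ∀ z, l y - l z ≤ ‖y - z‖ := by
    intro z
    rw [← map_sub]
    refine (le_abs_self _).trans ?_
    simpa [hl1] using l.le_opNorm (y - z)
  have key := nonneg_of_lap_nonpos (isOpen_diff_closedBall hΩ) (hb.subset sdiff_subset)
    (f := fun z => ((-1 / 2) * l z ^ 2 + (l y - D / 2) * l z + (D / 2 * l y - l y ^ 2 / 2)) - u z)
    (ContinuousOn.sub (by fun_prop) hu.1)
    (fun z hz => ⟨_, by rw [hle]; norm_num, (HasLap.quadratic l _ _ _ z).sub (hu.hasLap hz)⟩)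
    (fun z hz => ?_) x hx
  · have hx' := closure_mono sdiff_subset hx
    have hD0 : 0 ≤ D := (norm_nonneg _).trans (hD _ hx' _ hx')
    nlinarith [hle' x, sq_nonneg (l y - l x)]
  · rw [hu.2.2.2 z hz]
    have hz' := closure_mono sdiff_subset (frontier_subset_closure hz)
    nlinarith [hnn z hz', (hle' z).trans (hD y hy.1 z hz')]

/-- Comparison of the torsion function with its dilation centred at the hole. -/
lemma IsTorsion.log_le_dilation_sub (hΩ : IsOpen Ω) (hb : Bornology.IsBounded Ω)
    (hc : Convex ℝ Ω) (hu : IsTorsion (Ω \ closedBall c ε) u) (hε : 0 < ε)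
    (hB : closedBall c R ⊆ Ω) {m D : ℝ} (hm0 : 0 ≤ m) (hm : ∀ x, ‖x - c‖ = R → m ≤ u x)
    (hD : ∀ a ∈ closure Ω, ∀ b ∈ closure Ω, ‖a - b‖ ≤ D) {t : ℝ} (ht : 1 < t)
    (htR : t * ε < R) {x : E2} (hx : ε < ‖x - c‖) (hxt : c + t • (x - c) ∈ Ω) :
    m / (Real.log R - Real.log ε) * Real.log t
      - (m / (Real.log R - Real.log ε) * Real.log t + (t - 1) * (D ^ 2 / 2))
        / (Real.log R - Real.log ε - Real.log t) * (Real.log ‖x - c‖ - Real.log ε)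
      ≤ u (c + t • (x - c)) - u x := by
  have ht0 : 0 < t := by linarith
  have hεR : ε < R := by nlinarith
  have hR : 0 < R := hε.trans hεR
  have hcΩ : c ∈ Ω := hB (mem_closedBall_self hR.le)
  have hBε : closedBall c ε ⊆ Ω := (closedBall_subset_closedBall hεR.le).trans hB
  have hL : 0 < Real.log R - Real.log ε := sub_pos.mpr (Real.log_lt_log hε hεR)
  have hLt : 0 < Real.log R - Real.log ε - Real.log t := by
    have := Real.log_lt_log (by positivity) htR
    rw [Real.log_mul ht0.ne' hε.ne'] at this
    linarith
  set L := Real.log R - Real.log ε with hLdef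
  set a := m / L * Real.log t with ha
  have ha0 : 0 ≤ a := mul_nonneg (div_nonneg hm0 hL.le) (Real.log_nonneg ht.le)
  set b := (a + (t - 1) * (D ^ 2 / 2)) / (L - Real.log t) with hbdef
  have hb0 : 0 ≤ b := div_nonneg
    (add_nonneg ha0 (mul_nonneg (by linarith) (by positivity))) hLt.le
  have hbL : b * (L - Real.log t) = a + (t - 1) * (D ^ 2 / 2) := div_mul_cancel₀ _ hLt.ne'
  let T : E2 → E2 := fun y => c + t • (y - c)
  have hTc : Continuous T := by fun_prop
  have hTn : ∀ y, ‖T y - c‖ = t * ‖y - c‖ := fun y => by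
    simp only [T, add_sub_cancel_left, norm_smul, Real.norm_of_nonneg ht0.le]
  have hTin : ∀ y, T y ∈ Ω → y ∈ Ω := fun y hy => by
    have := hc.add_smul_sub_mem hcΩ hy (t := t⁻¹) ⟨by positivity, inv_le_one_of_one_le₀ ht.le⟩
    simpa [T, smul_smul, inv_mul_cancel₀ ht0.ne'] using this
  set U : Set E2 := T ⁻¹' Ω \ closedBall c ε with hUdef
  have hUΩ : U ⊆ Ω \ closedBall c ε := fun y hy => ⟨hTin y hy.1, hy.2⟩
  have hTU : MapsTo T U (Ω \ closedBall c ε) := fun y hy => ⟨hy.1, by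
    have := norm_sub_of_mem_diff hy
    rw [mem_closedBall_iff_norm, hTn, not_le]
    nlinarith⟩
  have hpos : ∀ y ∈ closure U, 0 < ‖y - c‖ := fun y hy =>
    hε.trans_le (le_norm_sub_of_mem_closure hy)
  have hTo : IsOpen (T ⁻¹' Ω) := hΩ.preimage hTc
  have key := nonneg_of_lap_nonpos (isOpen_diff_closedBall hTo)
    (hb.subset (hUΩ.trans sdiff_subset))
    (f := fun y => (u (c + t • (y - c)) - u y)
      + (b * Real.log ‖y - c‖ - (a + b * Real.log ε)))
    ((ContinuousOn.sub (hu.1.comp hTc.continuousOn (hTU.closure hTc))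
      (hu.1.mono (closure_mono hUΩ))).add
      ((continuousOn_const.mul (continuousOn_log_norm_sub hpos)).sub continuousOn_const))
    (fun y hy => ⟨_, by nlinarith, (((hu.hasLap (hTU hy)).comp_dilation).sub
      (hu.hasLap (hUΩ hy))).add (((HasLap.log_norm_sub
        (ne_of_norm_sub_pos (hpos y (subset_closure hy)))).const_mul b).sub
          (HasLap.const _ y))⟩)
    (fun y hy => ?_) x (subset_closure ⟨hxt, by
      rw [mem_closedBall_iff_norm, not_le]; exact hx⟩)
  · linarith
  · have hycl := frontier_subset_closure hy
    change 0 ≤ (u (T y) - u y) + (b * Real.log ‖y - c‖ - (a + b * Real.log ε))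
    rcases frontier_diff_closedBall_subset hTo hy with h | h
    · rw [hTo.frontier_eq] at h
      have hTcl : T y ∈ closure (Ω \ closedBall c ε) := hTU.closure hTc hycl
      have hTfr : T y ∈ frontier Ω := by
        rw [hΩ.frontier_eq]
        exact ⟨closure_mono sdiff_subset hTcl, h.2⟩
      have hyΩ := closure_mono hUΩ hycl
      have h1 := hu.le_mul_norm_sub hΩ hb hc hD hTfr hyΩ
      have h2 : ‖T y - y‖ = (t - 1) * ‖y - c‖ := by
        have : T y - y = (t - 1) • (y - c) := by simp only [T]; module
        rw [this, norm_smul, Real.norm_of_nonneg (by linarith)]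
      have h3 := hD y (closure_mono sdiff_subset hyΩ) c (subset_closure hcΩ)
      have hD0 : 0 ≤ D := (norm_nonneg _).trans h3
      have h4 : u y ≤ (t - 1) * (D ^ 2 / 2) := by
        rw [h2] at h1
        have := mul_le_mul_of_nonneg_left h3 (by nlinarith : 0 ≤ D / 2 * (t - 1))
        nlinarith
      have h5 : R ≤ t * ‖y - c‖ := by
        rw [← hTn]
        by_contra! hlt
        exact h.2 (hB (mem_closedBall_iff_norm.mpr hlt.le))
      have h6 := Real.log_le_log hR h5
      rw [Real.log_mul ht0.ne' (hpos y hycl).ne'] at h6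
      have h7 := mul_le_mul_of_nonneg_left
        (show L - Real.log t ≤ Real.log ‖y - c‖ - Real.log ε by linarith) hb0
      rw [hu.2.2.2 _ (frontier_subset_frontier_diff_closedBall hΩ hBε hTfr)]
      linarith
    · have h' : ‖y - c‖ = ε := h
      have h1 := hu.log_le hΩ hε hεR hB hm (x := T y) (by rw [hTn, h']; nlinarith)
        (by rw [hTn, h']; exact htR.le)
      rw [hTn, h', Real.log_mul ht0.ne' hε.ne', add_sub_cancel_right] at h1
      rw [hu.2.2.2 y (mem_frontier_diff_closedBall_of_norm_eq hΩ hBε hε h'), h']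
      linarith

/-- Lower bound for the radial derivative of the torsion function of a perforated convex set. -/
lemma IsTorsion.le_fderiv_radial (hΩ : IsOpen Ω) (hb : Bornology.IsBounded Ω)
    (hc : Convex ℝ Ω) (hu : IsTorsion (Ω \ closedBall c ε) u) (hε : 0 < ε) (hεR : ε < R)
    (hB : closedBall c R ⊆ Ω) {m D : ℝ} (hm0 : 0 ≤ m) (hm : ∀ x, ‖x - c‖ = R → m ≤ u x)
    (hD : ∀ a ∈ closure Ω, ∀ b ∈ closure Ω, ‖a - b‖ ≤ D) {x : E2}
    (hx : x ∈ Ω \ closedBall c ε) :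
    m / (Real.log R - Real.log ε)
      - (m / (Real.log R - Real.log ε) + D ^ 2 / 2) / (Real.log R - Real.log ε)
        * (Real.log ‖x - c‖ - Real.log ε) ≤ fderiv ℝ u x (x - c) := by
  have hL : 0 < Real.log R - Real.log ε := sub_pos.mpr (Real.log_lt_log hε hεR)
  set L := Real.log R - Real.log ε with hLdef
  set q := Real.log ‖x - c‖ - Real.log ε
  have hlog : HasDerivAt Real.log 1 1 := by simpa using Real.hasDerivAt_log one_ne_zero
  have hT : HasDerivAt (fun t : ℝ => c + t • (x - c)) (x - c) 1 := by
    simpa using ((hasDerivAt_id (1 : ℝ)).smul_const (x - c)).const_add c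
  have hT1 : c + (1 : ℝ) • (x - c) = x := by simp
  have hud : HasFDerivAt u (fderiv ℝ u x) (c + (1 : ℝ) • (x - c)) := by
    rw [hT1]
    exact ((hu.2.1 x hx).differentiableAt (by norm_num)).hasFDerivAt
  have hnum : HasDerivAt (fun t => m / L * Real.log t + (t - 1) * (D ^ 2 / 2))
      (m / L + D ^ 2 / 2) 1 := by
    simpa using (hlog.const_mul (m / L)).fun_add
      (((hasDerivAt_id (1 : ℝ)).sub_const 1).mul_const (D ^ 2 / 2))
  have hfrac : HasDerivAt (fun t => (m / L * Real.log t + (t - 1) * (D ^ 2 / 2))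
      / (L - Real.log t)) ((m / L + D ^ 2 / 2) / L) 1 := by
    refine (hnum.fun_div (hlog.const_sub L) (by simpa using hL.ne')).congr_deriv ?_
    simp only [Real.log_one, sub_self, mul_zero, zero_mul, add_zero, sub_zero]
    field_simp
  have hφ : HasDerivAt (fun t : ℝ => (u (c + t • (x - c)) - u x) - (m / L * Real.log t
      - (m / L * Real.log t + (t - 1) * (D ^ 2 / 2)) / (L - Real.log t) * q))
      (fderiv ℝ u x (x - c) - (m / L - (m / L + D ^ 2 / 2) / L * q)) 1 := by
    have h := ((hud.comp_hasDerivAt (1 : ℝ) hT).sub_const (u x)).fun_sub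
      ((hlog.const_mul (m / L)).fun_sub (hfrac.mul_const q))
    simpa using h
  have hlim := hφ.tendsto_slope.mono_left
    (nhdsWithin_mono (1 : ℝ) (fun t (ht : t ∈ Ioi 1) => (ne_of_gt ht : t ≠ 1)))
  have hev : ∀ᶠ t in 𝓝[>] (1 : ℝ), c + t • (x - c) ∈ Ω ∧ t * ε < R := by
    refine nhdsWithin_le_nhds ((hT.continuousAt.eventually
      (hΩ.mem_nhds (by simpa using hx.1))).and ?_)
    have : ContinuousAt (fun t : ℝ => t * ε) 1 := by fun_prop
    exact this.eventually (gt_mem_nhds (by simpa using hεR))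
  have hnonneg := ge_of_tendsto hlim (b := 0) (by
    filter_upwards [hev, self_mem_nhdsWithin] with t ht ht1
    have ht1' : (1 : ℝ) < t := ht1
    have := hu.log_le_dilation_sub hΩ hb hc hε hB hm0 hm hD ht1' ht.2
      (norm_sub_of_mem_diff hx) ht.1
    rw [slope_def_field]
    refine div_nonneg ?_ (by linarith)
    simp only [hT1, Real.log_one]
    simp only [sub_self, mul_zero, zero_mul, add_zero, zero_div, sub_zero]
    linarith)
  linarith

end Perforated

/-- Gradient lower bound next to the hole: there is `θ > 1` such that for
`ε < |x-x₀| ≤ θε` one has `|∇u_ε(x)| ≥ u₀(x₀)/(8ε|log ε|)`. -/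
theorem grad_lower_bound_near_sphere
    (Ω : Set E2) (hΩo : IsOpen Ω) (hΩb : Bornology.IsBounded Ω) (hΩc : Convex ℝ Ω)
    (u₀ : E2 → ℝ) (h₀ : IsTorsion Ω u₀) (h₀pos : ∀ x ∈ Ω, 0 < u₀ x)
    (x₀ : E2) (hx₀ : x₀ ∈ Ω)
    (ε₁ : ℝ) (hε₁ : 0 < ε₁) (hball : closedBall x₀ ε₁ ⊆ Ω)
    (uε : ℝ → E2 → ℝ)
    (huε : ∀ ε ∈ Ioo (0:ℝ) ε₁, IsTorsion (Ω \ closedBall x₀ ε) (uε ε)) :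
    ∃ θ > 1, ∃ ε₀ > 0, ε₀ ≤ ε₁ ∧ ∀ ε ∈ Ioo (0:ℝ) ε₀,
      ∀ x ∈ Ω \ closedBall x₀ ε, ε < ‖x - x₀‖ → ‖x - x₀‖ ≤ θ * ε →
        u₀ x₀ / (8 * ε * |Real.log ε|) ≤ ‖gradient (uε ε) x‖ := by
  obtain ⟨M, hM⟩ := hΩb.isCompact_closure.exists_bound_of_continuousOn h₀.1
  have hM' : ∀ x ∈ closure Ω, u₀ x ≤ M := fun x hx => (le_abs_self _).trans (hM x hx)
  have hx₀cl : x₀ ∈ closure Ω := subset_closure hx₀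
  have hM0 : 0 ≤ M := (norm_nonneg _).trans (hM x₀ hx₀cl)
  obtain ⟨D, hDε, hD⟩ : ∃ D, ε₁ < D ∧ ∀ a ∈ closure Ω, ∀ b ∈ closure Ω, ‖a - b‖ ≤ D := by
    refine ⟨Metric.diam (closure Ω) + ε₁ + 1, ?_, fun a ha b hb => ?_⟩
    · have := Metric.diam_nonneg (s := closure Ω)
      linarith
    · have := Metric.dist_le_diam_of_mem hΩb.closure ha hb
      rw [dist_eq_norm] at this
      linarith
  set m := u₀ x₀ / 2 with hmdef
  have hm : 0 < m := half_pos (h₀pos x₀ hx₀)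
  obtain ⟨r, hr, hru⟩ : ∃ r > 0, ∀ x, ‖x - x₀‖ < r → 3 / 2 * m < u₀ x := by
    have hcont := (h₀.2.1 x₀ hx₀).continuousAt
    have := hcont.eventually (lt_mem_nhds (show 3 / 2 * m < u₀ x₀ by linarith))
    obtain ⟨r, hr, h⟩ := Metric.eventually_nhds_iff.mp this
    exact ⟨r, hr, fun x hx => h (by rwa [dist_eq_norm])⟩
  set R := min (min ε₁ 1) (r / 2)
  have hR : 0 < R := by positivity
  have hRε₁ : R ≤ ε₁ := (min_le_left _ _).trans (min_le_left _ _)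
  have hR1 : R ≤ 1 := (min_le_left _ _).trans (min_le_right _ _)
  have hRr : R < r := (min_le_right _ _).trans_lt (half_lt_self hr)
  have hBR : closedBall x₀ R ⊆ Ω := (closedBall_subset_closedBall hRε₁).trans hball
  set B := max (1 - Real.log R)
    (M * (Real.log D - Real.log R) / (m / 2) - Real.log D)
  have hB1 : 1 - Real.log R ≤ B := le_max_left _ _
  have hB2 : M * (Real.log D - Real.log R) / (m / 2) - Real.log D ≤ B := le_max_right _ _
  set ρ := m / (2 * m + D ^ 2) with hρdef
  have hρ : 0 < ρ := by positivity
  have hρ1 : ρ ≤ 1 / 2 := by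
    rw [hρdef, div_le_div_iff₀ (by positivity) (by norm_num)]
    nlinarith [sq_nonneg D]
  have hρm : (m + D ^ 2 / 2) * ρ = m / 2 := by
    rw [hρdef]
    field_simp
  have hθ2 : Real.exp ρ ≤ 2 := by
    rw [← Real.le_log_iff_exp_le (by norm_num)]
    linarith [Real.log_two_gt_d9]
  refine ⟨Real.exp ρ, Real.one_lt_exp_iff.mpr hρ, min R (Real.exp (-B)), by positivity,
    (min_le_left _ _).trans hRε₁, ?_⟩
  rintro ε ⟨hε, hε0⟩ x hx hεx hxθ
  have hεR : ε < R := hε0.trans_le (min_le_left _ _)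
  have hlogε : Real.log ε < -B := by
    rw [Real.log_lt_iff_lt_exp hε]
    exact hε0.trans_le (min_le_right _ _)
  have hu := huε ε ⟨hε, hεR.trans_le hRε₁⟩
  have hεD : ε < D := (hεR.trans_le hRε₁).trans hDε
  have hlogR : Real.log R ≤ 0 := Real.log_nonpos hR.le hR1
  set L := Real.log R - Real.log ε with hLdef
  have hL1 : 1 ≤ L := by linarith
  have hLε : L ≤ |Real.log ε| := by linarith [neg_le_abs (Real.log ε)]
  have hmu : ∀ y, ‖y - x₀‖ = R → m ≤ uε ε y := by
    intro y hy
    have hyΩ : y ∈ Ω \ closedBall x₀ ε := ⟨hBR (mem_closedBall_iff_norm.mpr hy.le), by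
      rw [mem_closedBall_iff_norm, hy, not_le]
      exact hεR⟩
    have h1 := h₀.sub_log_le hΩo hΩb hu hε hM0 hM' (fun z hz => hD z hz x₀ hx₀cl) hεD
      (subset_closure hyΩ)
    have h2 := hru y (hy ▸ hRr)
    have h3 : M / (Real.log D - Real.log ε) * (Real.log D - Real.log R) ≤ m / 2 := by
      have hLD : 0 < Real.log D - Real.log ε := sub_pos.mpr (Real.log_lt_log hε hεD)
      have h4 : M * (Real.log D - Real.log R) / (m / 2) ≤ Real.log D - Real.log ε := by linarith
      rw [div_le_iff₀ (by positivity)] at h4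
      rw [div_mul_eq_mul_div, div_le_iff₀ hLD]
      linarith
    rw [hy] at h1
    linarith
  have hrad := hu.le_fderiv_radial hΩo hΩb hΩc hε hεR hBR hm.le hmu hD hx
  rw [← hLdef] at hrad
  have hxpos : 0 < ‖x - x₀‖ := hε.trans hεx
  have hq0 : 0 ≤ Real.log ‖x - x₀‖ - Real.log ε := sub_nonneg.mpr (Real.log_le_log hε hεx.le)
  have hqρ : Real.log ‖x - x₀‖ - Real.log ε ≤ ρ := by
    have := Real.log_le_log hxpos hxθ
    rw [Real.log_mul (Real.exp_pos ρ).ne' hε.ne', Real.log_exp] at this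
    linarith
  have hgrad : fderiv ℝ (uε ε) x (x - x₀) ≤ ‖gradient (uε ε) x‖ * (2 * ε) := by
    have h1 : ‖gradient (uε ε) x‖ = ‖fderiv ℝ (uε ε) x‖ := by
      rw [gradient, LinearIsometryEquiv.norm_map]
    rw [h1]
    refine (le_abs_self _).trans (((fderiv ℝ (uε ε) x).le_opNorm _).trans ?_)
    gcongr
    exact hxθ.trans (by gcongr)
  have hLpos : 0 < L := by linarith
  have hnum : (m / L + D ^ 2 / 2) * (Real.log ‖x - x₀‖ - Real.log ε) ≤ m / 2 := by
    rw [← hρm]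
    gcongr
    exact div_le_self hm.le hL1
  have hmain : m / 2 ≤ ‖gradient (uε ε) x‖ * (2 * ε) * L := by
    rw [← div_le_iff₀ hLpos]
    refine le_trans ?_ (hrad.trans hgrad)
    rw [div_mul_eq_mul_div, ← sub_div]
    gcongr
    linarith
  have hfin : ‖gradient (uε ε) x‖ * (2 * ε) * L ≤
      ‖gradient (uε ε) x‖ * (2 * ε) * |Real.log ε| := by gcongr
  rw [div_le_iff₀ (mul_pos (by positivity) (hLpos.trans_le hLε))]
  linarith
end
end
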